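/- For every ε > 0 there exist δ > 0 and a positive integer N such that for all n ≥ N the following holds. Suppose G and G′ are simple graphs, each on n vertices, each with independence number at most δn, each admitting a partition of its edge set into a part with no clique on 3 vertices and a part with no clique on 6 vertices, and each having at least (5/12 − δ)·n² edges. Then there is a bijection σ from V(G) to V(G′) such that the symmetric difference of E(G′) and the image of E(G) under σ has size at most ε·n². -/

import Mathlib

section

open Finset

namespace RT36

/-- quadratic form -/
noncomputable def quad {ι : Type*} [Fintype ι] (w : ι → ι → ℝ) (x : ι → ℝ) : ℝ :=
  ∑ i, ∑ j, w i j * x i * x j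

noncomputable def lin {ι : Type*} [Fintype ι] (w : ι → ι → ℝ) (x : ι → ℝ) (i : ι) : ℝ :=
  ∑ j, w i j * x j

lemma quad_eq_lin {ι : Type*} [Fintype ι] (w : ι → ι → ℝ) (x : ι → ℝ) :
    quad w x = ∑ i, x i * lin w x i := by
  unfold quad lin
  refine sum_congr rfl fun i _ => ?_
  rw [mul_sum]
  exact sum_congr rfl fun j _ => by ring

lemma lin_add {ι : Type*} [Fintype ι] (w : ι → ι → ℝ) (x y : ι → ℝ) (i : ι) :
    lin w (x + y) i = lin w x i + lin w y i := by
  unfold lin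
  rw [← sum_add_distrib]
  exact sum_congr rfl fun j _ => by simp [mul_add]

lemma lin_swap {ι : Type*} [Fintype ι] (w : ι → ι → ℝ) (hs : ∀ i j, w i j = w j i)
    (x y : ι → ℝ) : ∑ i, x i * lin w y i = ∑ i, y i * lin w x i := by
  unfold lin
  simp_rw [mul_sum]
  rw [sum_comm]
  refine sum_congr rfl fun i _ => sum_congr rfl fun j _ => ?_
  rw [hs j i]; ring

lemma quad_add {ι : Type*} [Fintype ι] (w : ι → ι → ℝ) (hs : ∀ i j, w i j = w j i)
    (x y : ι → ℝ) : quad w (x + y) = quad w x + 2 * ∑ i, y i * lin w x i + quad w y := by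
  rw [quad_eq_lin, quad_eq_lin, quad_eq_lin]
  simp_rw [lin_add, Pi.add_apply]
  have := lin_swap w hs x y
  simp_rw [add_mul, mul_add, sum_add_distrib]
  linarith

lemma quad_shift {ι : Type*} [Fintype ι] [DecidableEq ι] (w : ι → ι → ℝ)
    (hs : ∀ i j, w i j = w j i) (hd : ∀ i, w i i = 0)
    (x : ι → ℝ) (u v : ι) (s : ℝ) :
    quad w (x + (Pi.single u s + Pi.single v (-s))) =
      quad w x + 2 * s * (lin w x u - lin w x v) - 2 * s ^ 2 * w u v := by
  rw [quad_add w hs]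
  have h1 : ∀ z : ι → ℝ, ∑ i, (Pi.single u s + Pi.single v (-s) : ι → ℝ) i * z i
      = s * z u - s * z v := by
    intro z
    simp [add_mul, sum_add_distrib, Pi.single_apply]
    ring
  have h2 : ∀ i, lin w (Pi.single u s + Pi.single v (-s) : ι → ℝ) i
      = s * w i u - s * w i v := by
    intro i
    rw [← h1 (w i)]
    unfold lin
    exact sum_congr rfl fun j _ => mul_comm _ _
  have h3 := quad_eq_lin w (Pi.single u s + Pi.single v (-s) : ι → ℝ)
  rw [h1, h2, h2, hd, hd, hs v u] at h3
  rw [h1, h3]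
  ring

lemma lagrange {ι : Type*} [Fintype ι] (w : ι → ι → ℝ)
    (hs : ∀ i j, w i j = w j i) (hd : ∀ i, w i i = 0) (q : ι → ℝ) (hq : ∀ i, 0 ≤ q i)
    (hq1 : ∑ i, q i = 1) :
    ∃ x : ι → ℝ, (∀ i, 0 ≤ x i) ∧ ∑ i, x i = 1 ∧ (∀ i, q i = 0 → x i = 0) ∧
      quad w q ≤ quad w x ∧ (∀ v, 0 < x v → lin w x v = quad w x) ∧
      ∀ u v, u ≠ v → 0 < x u → 0 < x v → w u v ≠ 0 := by
  classical
  set K : Set (ι → ℝ) := stdSimplex ℝ ι ∩ {x | ∀ i, q i = 0 → x i = 0} with hK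
  have hKc : IsCompact K := by
    refine (isCompact_stdSimplex ℝ ι).inter_right ?_
    have : {x : ι → ℝ | ∀ i, q i = 0 → x i = 0} = ⋂ i, ⋂ (_ : q i = 0), {x | x i = 0} := by
      ext; simp
    rw [this]
    exact isClosed_iInter fun i => isClosed_iInter fun _ =>
      isClosed_eq (continuous_apply i) continuous_const
  have hqK : q ∈ K := ⟨⟨hq, hq1⟩, fun i h => h⟩
  have hcont : Continuous (quad w) := by
    unfold quad; fun_prop
  obtain ⟨x0, hx0K, hx0⟩ := hKc.exists_isMaxOn ⟨q, hqK⟩ hcont.continuousOn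
  have hx0' : ∀ y ∈ K, quad w y ≤ quad w x0 := fun y hy => hx0 hy
  -- choose minimal support
  have hex : ∃ k : ℕ, ∃ x ∈ K, quad w x = quad w x0 ∧ (univ.filter fun i => x i ≠ 0).card = k :=
    ⟨_, x0, hx0K, rfl, rfl⟩
  obtain ⟨x, hxK, hxv, hxk⟩ := Nat.find_spec hex
  have hmin : ∀ y ∈ K, quad w y = quad w x0 →
      (univ.filter fun i => x i ≠ 0).card ≤ (univ.filter fun i => y i ≠ 0).card := by
    intro y hy hyv
    rw [hxk]
    exact Nat.find_min' hex ⟨y, hy, hyv, rfl⟩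
  have hmem : ∀ u v s, u ≠ v → 0 < x u → 0 < x v → -x u ≤ s → s ≤ x v →
      x + (Pi.single u s + Pi.single v (-s)) ∈ K := by
    intro u v s huv hu hv h1 h2
    refine ⟨⟨fun i => ?_, ?_⟩, fun i hi => ?_⟩
    · have := hxK.1.1 i
      simp only [Pi.add_apply, Pi.single_apply]
      by_cases hiu : i = u
      · subst hiu; simp [huv]; linarith
      · by_cases hiv : i = v
        · subst hiv; simp [hiu]; linarith
        · simp [hiu, hiv]; linarith
    · simp only [Pi.add_apply, sum_add_distrib]
      have := hxK.1.2
      simp [this]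
    · have h0 := hxK.2 i hi
      have hiu : i ≠ u := by rintro rfl; linarith
      have hiv : i ≠ v := by rintro rfl; linarith
      simp [hiu, hiv, h0]
  have hlin : ∀ u v, 0 < x u → 0 < x v → lin w x u ≤ lin w x v := by
    intro u v hu hv
    by_contra hlt
    push Not at hlt
    have huv : u ≠ v := by rintro rfl; exact lt_irrefl _ hlt
    set D := lin w x u - lin w x v with hD
    have hDp : 0 < D := by linarith
    set s := min (x v) (D / (2 * (|w u v| + 1))) with hsdef
    have hsp : 0 < s := lt_min hv (by positivity)
    have hK' := hx0' _ (hmem u v s huv hu hv (by linarith) (min_le_left _ _))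
    rw [quad_shift w hs hd, hxv] at hK'
    have h3 : s ≤ D / (2 * (|w u v| + 1)) := min_le_right _ _
    rw [le_div_iff₀ (by positivity)] at h3
    have h4 : w u v ≤ |w u v| := le_abs_self _
    have h5 : s * (D - s * w u v) ≤ 0 := by nlinarith
    have h6 : 0 < D - s * w u v := by nlinarith
    nlinarith [mul_pos hsp h6]
  refine ⟨x, hxK.1.1, hxK.1.2, hxK.2, hxv ▸ hx0' q hqK, ?_, ?_⟩
  · intro v hv
    rw [quad_eq_lin]
    have : ∀ i ∈ univ, x i * lin w x i = x i * lin w x v := by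
      intro i _
      rcases (hxK.1.1 i).eq_or_lt with h | h
      · rw [← h]; simp
      · rw [le_antisymm (hlin i v h hv) (hlin v i hv h)]
    rw [sum_congr rfl this, ← sum_mul, hxK.1.2, one_mul]
  · intro u v huv hu hv hw
    have hK' := hmem u v (x v) huv hu hv (by linarith) le_rfl
    have hval : quad w (x + (Pi.single u (x v) + Pi.single v (-(x v)))) = quad w x0 := by
      rw [quad_shift w hs hd, hw, le_antisymm (hlin u v hu hv) (hlin v u hv hu), ← hxv]; ring
    have := hmin _ hK' hval
    have hlt : (univ.filter fun i => (x + (Pi.single u (x v) + Pi.single v (-(x v))) : ι → ℝ) i ≠ 0).card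
        < (univ.filter fun i => x i ≠ 0).card := by
      apply card_lt_card
      rw [ssubset_iff_of_subset]
      · refine ⟨v, by simp [hv.ne'], ?_⟩
        simp [huv.symm]
      · intro i hi
        simp only [mem_filter, mem_univ, true_and] at hi ⊢
        intro h0
        apply hi
        have hiu : i ≠ u := by rintro rfl; linarith
        have hiv : i ≠ v := by rintro rfl; linarith
        simp [h0, hiu, hiv]
    omega

end RT36

end

section

open Finset

namespace RT36

/-- Abstract reduced structure. -/
structure Sys (ι : Type*) where
  R : ι → Prop
  red : ι → ι → Prop
  bl : ι → ι → Prop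
  fb : ι → ι → Prop
  red_symm : ∀ i j, red i j → red j i
  bl_symm : ∀ i j, bl i j → bl j i
  fb_symm : ∀ i j, fb i j → fb j i
  red_irr : ∀ i, ¬ red i i
  bl_irr : ∀ i, ¬ bl i i
  fb_bl : ∀ i j, fb i j → bl i j
  red_tri : ∀ a b c, red a b → red b c → red a c → False
  red_R : ∀ i j, R i → red i j → False
  noclq : ∀ l q : List ι, l.Pairwise bl → q.Pairwise fb → (∀ i ∈ q, ¬ R i) →
    (∀ i ∈ l, ∀ j ∈ q, bl i j) → 6 ≤ l.length + 2 * q.length → False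

namespace Sys
variable {ι : Type*} (s : Sys ι)

def full (i j : ι) : Prop := s.red i j ∨ s.fb i j ∨ (s.bl i j ∧ (s.R i ∨ s.R j))

def h (i j : ι) : Prop := s.bl i j ∧ ¬ s.full i j

open Classical in
noncomputable def w (i j : ι) : ℝ := if s.full i j then 1 else if s.bl i j then 1 / 2 else 0

lemma full_symm {i j : ι} (hf : s.full i j) : s.full j i := by
  rcases hf with a | a | ⟨a, b⟩
  · exact Or.inl (s.red_symm _ _ a)
  · exact Or.inr (Or.inl (s.fb_symm _ _ a))
  · exact Or.inr (Or.inr ⟨s.bl_symm _ _ a, b.symm⟩)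

lemma full_comm (i j : ι) : s.full i j ↔ s.full j i := ⟨s.full_symm, s.full_symm⟩
lemma bl_comm (i j : ι) : s.bl i j ↔ s.bl j i := ⟨s.bl_symm _ _, s.bl_symm _ _⟩

lemma h_symm {i j : ι} (hf : s.h i j) : s.h j i :=
  ⟨s.bl_symm _ _ hf.1, fun h => hf.2 (s.full_symm h)⟩

lemma full_irr (i : ι) : ¬ s.full i i := by
  rintro (a | a | ⟨a, -⟩)
  · exact s.red_irr _ a
  · exact s.bl_irr _ (s.fb_bl _ _ a)
  · exact s.bl_irr _ a

lemma w_symm (i j : ι) : s.w i j = s.w j i := by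
  have h1 := s.full_comm i j
  have h2 := s.bl_comm i j
  unfold w
  by_cases a : s.full i j <;> by_cases b : s.bl i j <;> simp_all

lemma w_diag (i : ι) : s.w i i = 0 := by
  unfold w; simp [s.full_irr, s.bl_irr]

lemma w_nonneg (i j : ι) : 0 ≤ s.w i j := by
  unfold w; split_ifs <;> norm_num

lemma w_le_one (i j : ι) : s.w i j ≤ 1 := by
  unfold w; split_ifs <;> norm_num

lemma w_full {i j : ι} (hf : s.full i j) : s.w i j = 1 := by
  unfold w; simp [hf]

lemma w_h {i j : ι} (hf : s.h i j) : s.w i j = 1 / 2 := by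
  unfold w; simp [hf.1, hf.2]

lemma w_cases (i j : ι) : (s.full i j ∧ s.w i j = 1) ∨ (s.h i j ∧ s.w i j = 1 / 2) ∨ s.w i j = 0 := by
  unfold w h
  by_cases a : s.full i j <;> by_cases b : s.bl i j <;> simp_all

lemma w_ne {i j : ι} (hw : s.w i j ≠ 0) : s.full i j ∨ s.h i j := by
  rcases s.w_cases i j with h | h | h
  · exact Or.inl h.1
  · exact Or.inr h.1
  · exact absurd h hw

lemma w_zero {i j : ι} (hw : s.w i j = 0) : ¬ s.red i j ∧ ¬ s.bl i j := by
  unfold w at hw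
  constructor
  · intro hr
    have : s.full i j := Or.inl hr
    rw [if_pos this] at hw; norm_num at hw
  · intro hr
    split_ifs at hw <;> norm_num at hw

/-- pairwise nonzero -/
def NZ (S : Finset ι) : Prop := ∀ u ∈ S, ∀ v ∈ S, u ≠ v → s.full u v ∨ s.h u v

variable {s}

lemma NZ.red_or_bl {S : Finset ι} (hS : s.NZ S) {u v : ι} (hu : u ∈ S) (hv : v ∈ S) (huv : u ≠ v)
    (hr : ¬ s.red u v) : s.bl u v := by
  rcases hS u hu v hv huv with (a | a | a) | a
  · exact absurd a hr
  · exact s.fb_bl _ _ a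
  · exact a.1
  · exact a.1

lemma NZ.R_bl {S : Finset ι} (hS : s.NZ S) {u v : ι} (hu : u ∈ S) (hv : v ∈ S) (huv : u ≠ v)
    (hr : s.R u) : s.bl u v :=
  hS.red_or_bl hu hv huv fun h => s.red_R _ _ hr h

open Classical in
lemma cap {S : Finset ι} (hS : s.NZ S) (l q : List ι) (hl : l.Pairwise s.bl)
    (hq : q.Pairwise s.fb) (hlS : ∀ i ∈ l, i ∈ S ∧ ¬ s.R i) (hqS : ∀ i ∈ q, i ∈ S ∧ ¬ s.R i)
    (hlq : ∀ i ∈ l, ∀ j ∈ q, s.bl i j) :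
    (S.filter s.R).card + l.length + 2 * q.length ≤ 5 := by
  by_contra hcon
  refine s.noclq ((S.filter s.R).toList ++ l) q ?_ hq (fun i hi => (hqS i hi).2) ?_ ?_
  · rw [List.pairwise_append]
    refine ⟨?_, hl, ?_⟩
    · refine (Finset.nodup_toList _).pairwise_of_forall_ne ?_
      intro a ha b hb hab
      simp only [mem_toList, mem_filter] at ha hb
      exact hS.R_bl ha.1 hb.1 hab ha.2
    · intro a ha b hb
      simp only [mem_toList, mem_filter] at ha
      refine hS.R_bl ha.1 (hlS b hb).1 ?_ ha.2
      rintro rfl; exact (hlS _ hb).2 ha.2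
  · intro i hi j hj
    rw [List.mem_append] at hi
    rcases hi with ha | hi
    · simp only [mem_toList, mem_filter] at ha
      refine hS.R_bl ha.1 (hqS j hj).1 ?_ ha.2
      rintro rfl; exact (hqS _ hj).2 ha.2
    · exact hlq i hi j hj
  · simp; omega

open Classical in
lemma capT {S : Finset ι} (hS : s.NZ S) (T : Finset ι) (hTS : ∀ i ∈ T, i ∈ S ∧ ¬ s.R i)
    (hT : ∀ u ∈ T, ∀ v ∈ T, u ≠ v → s.bl u v) (hne : T.Nonempty) :
    (S.filter s.R).card + T.card + 1 ≤ 5 := by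
  obtain ⟨u, hu⟩ := hne
  have := cap hS (T.erase u).toList [u] ?_ (by simp) ?_ (by simpa using hTS u hu) ?_
  · rw [length_toList, card_erase_of_mem hu] at this
    have : 0 < T.card := card_pos.2 ⟨u, hu⟩
    simp at *; omega
  · refine (Finset.nodup_toList _).pairwise_of_forall_ne ?_
    intro a ha b hb hab
    simp only [mem_toList, mem_erase] at ha hb
    exact hT a ha.2 b hb.2 hab
  · intro i hi
    simp only [mem_toList, mem_erase] at hi
    exact hTS i hi.2
  · intro i hi j hj
    simp only [mem_toList, mem_erase] at hi
    simp only [List.mem_singleton] at hj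
    subst hj
    exact hT i hi.2 _ hu hi.1

/-- Ramsey (3,3) -/
lemma ramsey33 (r : ι → ι → Prop) (hr : ∀ a b, r a b → r b a) (T : Finset ι) (hT : 6 ≤ T.card) :
    ∃ a ∈ T, ∃ b ∈ T, ∃ c ∈ T, a ≠ b ∧ b ≠ c ∧ a ≠ c ∧
      ((r a b ∧ r b c ∧ r a c) ∨ (¬ r a b ∧ ¬ r b c ∧ ¬ r a c)) := by
  classical
  obtain ⟨v, hv⟩ : T.Nonempty := card_pos.1 (by omega)
  have hc : ((T.erase v).filter (r v)).card + ((T.erase v).filter (fun u => ¬ r v u)).card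
      = (T.erase v).card := card_filter_add_card_filter_not _
  rw [card_erase_of_mem hv] at hc
  have key : ∀ p : ι → ι → Prop, (∀ a b, p a b → p b a) → 3 ≤ ((T.erase v).filter (p v)).card →
      ∃ a ∈ T, ∃ b ∈ T, ∃ c ∈ T, a ≠ b ∧ b ≠ c ∧ a ≠ c ∧
        ((p a b ∧ p b c ∧ p a c) ∨ (¬ p a b ∧ ¬ p b c ∧ ¬ p a c)) := by
    intro p hp h3
    obtain ⟨a, ha, b, hb, c, hc, hab, hac, hbc⟩ := Finset.two_lt_card.1 (show 2 < _ from h3)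
    simp only [mem_filter, mem_erase] at ha hb hc
    by_cases h1 : p a b
    · exact ⟨v, hv, a, ha.1.2, b, hb.1.2, ha.1.1.symm, hab, hb.1.1.symm, Or.inl ⟨ha.2, h1, hb.2⟩⟩
    by_cases h2 : p b c
    · exact ⟨v, hv, b, hb.1.2, c, hc.1.2, hb.1.1.symm, hbc, hc.1.1.symm, Or.inl ⟨hb.2, h2, hc.2⟩⟩
    by_cases h3 : p a c
    · exact ⟨v, hv, a, ha.1.2, c, hc.1.2, ha.1.1.symm, hac, hc.1.1.symm, Or.inl ⟨ha.2, h3, hc.2⟩⟩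
    exact ⟨a, ha.1.2, b, hb.1.2, c, hc.1.2, hab, hbc, hac, Or.inr ⟨h1, h2, h3⟩⟩
  by_cases h3 : 3 ≤ ((T.erase v).filter (r v)).card
  · exact key r hr h3
  · obtain ⟨a, ha, b, hb, c, hc, h1, h2, h3, h4⟩ := key (fun u v => ¬ r u v)
      (fun a b h h' => h (hr _ _ h')) (by
        have h5 : 3 ≤ ((T.erase v).filter (fun u => ¬ r v u)).card := by omega
        convert h5)
    refine ⟨a, ha, b, hb, c, hc, h1, h2, h3, ?_⟩
    simp only [not_not] at h4
    exact h4.symm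

/-- fully adjacent clique -/
def FullK (s : Sys ι) (C : Finset ι) : Prop := ∀ u ∈ C, ∀ v ∈ C, u ≠ v → s.full u v

lemma FullK.nz {C : Finset ι} (hC : s.FullK C) : s.NZ C := fun u hu v hv huv => Or.inl (hC u hu v hv huv)

lemma FullK.fb {C : Finset ι} (hC : s.FullK C) {u v : ι} (hu : u ∈ C) (hv : v ∈ C) (huv : u ≠ v)
    (hr : ¬ s.red u v) (h1 : ¬ s.R u) (h2 : ¬ s.R v) : s.fb u v := by
  rcases hC u hu v hv huv with a | a | a
  · exact absurd a hr
  · exact a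
  · rcases a.2 with b | b <;> contradiction

open Classical in
lemma two_R {S : Finset ι} (hS : s.NZ S) {C : Finset ι} (hCS : C ⊆ S) (hC : s.FullK C)
    (hR : ∀ u ∈ C, ¬ s.R u) (h3 : 3 ≤ C.card) : (S.filter s.R).card ≤ 1 := by
  obtain ⟨a, ha, b, hb, c, hc, hab, hac, hbc⟩ := Finset.two_lt_card.1 (show 2 < _ from h3)
  have key : ∀ u ∈ C, ∀ v ∈ C, u ≠ v → ¬ s.red u v → (S.filter s.R).card ≤ 1 := by
    intro u hu v hv huv hr
    have := cap hS [] [u, v] (by simp) (by simpa using hC.fb hu hv huv hr (hR u hu) (hR v hv))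
      (by simp) (by simp; exact ⟨⟨hCS hu, hR u hu⟩, hCS hv, hR v hv⟩) (by simp)
    simp at this; omega
  by_cases h1 : s.red a b
  · by_cases h2 : s.red b c
    · by_cases h3 : s.red a c
      · exact (s.red_tri a b c h1 h2 h3).elim
      · exact key a ha c hc hac h3
    · exact key b hb c hc hbc h2
  · exact key a ha b hb hab h1

/-- no vertex is joined to all of a full 6-clique -/
lemma claimZ {C : Finset ι} (hC6 : C.card = 6) (hC : s.FullK C) (v : ι)
    (hv : ∀ c ∈ C, s.w v c ≠ 0) : False := by
  classical
  have hvC : v ∉ C := fun h => hv v h (s.w_diag v)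
  have hS : s.NZ (insert v C) := by
    intro a ha b hb hab
    rw [mem_insert] at ha hb
    rcases ha with rfl | ha
    · rcases hb with rfl | hb
      · exact absurd rfl hab
      · exact s.w_ne (hv b hb)
    · rcases hb with rfl | hb
      · exact s.w_ne (by rw [s.w_symm]; exact hv a ha)
      · exact Or.inl (hC a ha b hb hab)
  set r := ((insert v C).filter s.R).card with hr
  have hsplit : (C.filter s.R).card + (C.filter (fun u => ¬ s.R u)).card = C.card :=
    card_filter_add_card_filter_not _
  have hle : (C.filter s.R).card ≤ r := card_le_card (filter_subset_filter _ (subset_insert _ _))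
  set b := C.filter (fun u => ¬ s.R u) with hb
  have hr5 : r ≤ 5 := by simpa using cap hS [] [] (by simp) (by simp) (by simp) (by simp) (by simp)
  have hbne : b.Nonempty := card_pos.1 (by omega)
  have hr3 : r ≤ 3 := by
    obtain ⟨u, hu⟩ := hbne
    rw [hb, mem_filter] at hu
    have := cap hS [] [u] (by simp) (by simp) (by simp) (by simp [hu]) (by simp)
    simp at this; omega
  have hr1 : r ≤ 1 := by
    refine two_R hS (C := b) ((filter_subset _ _).trans (subset_insert _ _)) ?_ ?_ (by omega)
    · intro x hx y hy hxy
      exact hC x (mem_of_mem_filter x hx) y (mem_of_mem_filter y hy) hxy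
    · intro u hu
      exact (mem_filter.1 hu).2
  by_cases hR0 : (C.filter s.R).card = 0
  · obtain ⟨a, ha, b', hb', c, hc, h1, h2, h3, h4⟩ := ramsey33 s.red s.red_symm b (by omega)
    rcases h4 with h4 | h4
    · exact s.red_tri _ _ _ h4.1 h4.2.1 h4.2.2
    · rw [hb, mem_filter] at ha hb' hc
      have := cap hS [] [a, b', c] (by simp) (by
        simp; exact ⟨⟨hC.fb ha.1 hb'.1 h1 h4.1 ha.2 hb'.2, hC.fb ha.1 hc.1 h3 h4.2.2 ha.2 hc.2⟩,
          hC.fb hb'.1 hc.1 h2 h4.2.1 hb'.2 hc.2⟩) (by simp) (by simp [ha, hb', hc]) (by simp)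
      simp at this
  · have hr1' : r = 1 := by omega
    have hvR : ¬ s.R v := by
      intro hvR
      have : r = (C.filter s.R).card + 1 := by
        rw [hr, filter_insert, if_pos hvR, card_insert_of_notMem]
        simp [hvC]
      omega
    have hvb : v ∉ b := fun h => hvC (mem_of_mem_filter v h)
    obtain ⟨a, ha, b', hb', c, hc, h1, h2, h3, h4⟩ := ramsey33 s.red s.red_symm (insert v b)
      (by rw [card_insert_of_notMem hvb]; omega)
    have hmem : ∀ u ∈ insert v b, u ∈ insert v C ∧ ¬ s.R u := by
      intro u hu
      rw [mem_insert] at hu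
      rcases hu with rfl | hu
      · exact ⟨mem_insert_self _ _, hvR⟩
      · rw [hb, mem_filter] at hu
        exact ⟨mem_insert_of_mem hu.1, hu.2⟩
    rcases h4 with h4 | h4
    · exact s.red_tri _ _ _ h4.1 h4.2.1 h4.2.2
    · have key : ∀ x ∈ insert v b, ∀ y ∈ insert v b, ∀ z ∈ insert v b, x ≠ y → y ≠ z → x ≠ z →
          ¬ s.red x y → ¬ s.red y z → ¬ s.red x z → x ≠ v → y ≠ v → False := by
        intro x hx y hy z hz hxy hyz hxz r1 r2 r3 hxv hyv
        have hx' := hmem x hx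
        have hy' := hmem y hy
        have hz' := hmem z hz
        have f := hC.fb (mem_of_mem_insert_of_ne hx'.1 hxv) (mem_of_mem_insert_of_ne hy'.1 hyv) hxy r1
          hx'.2 hy'.2
        have := cap hS [z] [x, y] (by simp) (by simpa using f) (by simpa using hz')
          (by simp [hx'.2, hy'.2]; exact ⟨by simpa using hx'.1, by simpa using hy'.1⟩) (by
            simp only [List.mem_cons, List.not_mem_nil, or_false]
            rintro i rfl j (rfl | rfl)
            · exact s.bl_symm _ _ (hS.red_or_bl hx'.1 hz'.1 hxz r3)
            · exact s.bl_symm _ _ (hS.red_or_bl hy'.1 hz'.1 hyz r2))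
        simp only [List.length_cons, List.length_nil] at this; omega
      have sy : ∀ x y, ¬ s.red x y → ¬ s.red y x := fun x y h h' => h (s.red_symm _ _ h')
      by_cases hav : a = v
      · exact key b' hb' c hc a ha h2 h3.symm h1.symm h4.2.1 (sy _ _ h4.2.2) (sy _ _ h4.1)
          (by rintro rfl; exact h1 hav) (by rintro rfl; exact h3 hav)
      · by_cases hbv : b' = v
        · exact key a ha c hc b' hb' h3 h2.symm h1 h4.2.2 (sy _ _ h4.2.1) h4.1 hav
            (by rintro rfl; exact h2 hbv)
        · exact key a ha b' hb' c hc h1 h2 h3 h4.1 h4.2.1 h4.2.2 hav hbv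

end Sys
end RT36

end

section

open Finset

namespace RT36
namespace Sys
set_option linter.unusedSectionVars false
open Classical in
/-- An optimal weighting on its support `S`. -/
structure Opt {ι : Type*} [Fintype ι] (s : Sys ι) (x : ι → ℝ) (S : Finset ι) (t : ℝ) : Prop where
  pos : ∀ v ∈ S, 0 < x v
  sum : ∑ v ∈ S, x v = 1
  nz : s.NZ S
  eq : ∀ v ∈ S, x v + 1 / 2 * ∑ u ∈ S.filter (s.h v), x u = t
  lt : t < 17 / 100

variable {ι : Type*} [Fintype ι] {s : Sys ι} {x : ι → ℝ} {S : Finset ι} {t : ℝ}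

lemma Opt.h_le (o : s.Opt x S t) {v : ι} (hv : v ∈ S) (U : Finset ι) (hU : U ⊆ S)
    (hh : ∀ u ∈ U, s.h v u) : x v + 1 / 2 * ∑ u ∈ U, x u ≤ t := by
  classical
  have h1 := o.eq v hv
  have h2 : ∑ u ∈ U, x u ≤ ∑ u ∈ S.filter (s.h v), x u := by
    refine sum_le_sum_of_subset_of_nonneg ?_ fun i hi _ => (o.pos i (mem_of_mem_filter i hi)).le
    intro u hu
    exact mem_filter.2 ⟨hU hu, hh u hu⟩
  convert (show x v + 1 / 2 * ∑ u ∈ U, x u ≤ t from by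
    have h1' : x v + 1 / 2 * ∑ u ∈ S.filter (s.h v), x u = t := by convert h1
    linarith)

lemma Opt.le_t (o : s.Opt x S t) {v : ι} (hv : v ∈ S) : x v ≤ t := by
  have := o.h_le hv ∅ (by simp) (by simp)
  simpa using this

lemma Opt.t_pos (o : s.Opt x S t) : 0 < t := by
  obtain ⟨v, hv⟩ : S.Nonempty := by
    by_contra h
    rw [not_nonempty_iff_eq_empty] at h
    have := o.sum
    simp [h] at this
  exact (o.pos v hv).trans_le (o.le_t hv)

lemma Opt.card_le (o : s.Opt x S t) (T : Finset ι) (hT : T ⊆ S) : ∑ v ∈ T, x v ≤ T.card * t := by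
  rw [← nsmul_eq_mul]
  exact sum_le_card_nsmul _ _ _ fun v hv => o.le_t (hT hv)

lemma Opt.hclique (o : s.Opt x S t) (T : Finset ι) (hT : T ⊆ S)
    (hh : ∀ u ∈ T, ∀ v ∈ T, u ≠ v → s.h u v) :
    (T.card + 1) * ∑ v ∈ T, x v ≤ 2 * T.card * t := by
  classical
  have h1 : ∀ v ∈ T, 1 / 2 * x v + 1 / 2 * ∑ u ∈ T, x u ≤ t := by
    intro v hv
    have := o.h_le (hT hv) (T.erase v) ((erase_subset _ _).trans hT) (fun u hu =>
      hh v hv u (mem_of_mem_erase hu) (ne_of_mem_erase hu).symm)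
    have h2 := add_sum_erase T x hv
    linarith
  have h2 := sum_le_card_nsmul T _ t h1
  rw [sum_add_distrib, ← mul_sum, sum_const, nsmul_eq_mul, nsmul_eq_mul] at h2
  linarith

lemma Opt.hpair (o : s.Opt x S t) {u v : ι} (hu : u ∈ S) (hv : v ∈ S) (huv : s.h u v) :
    x u + x v ≤ 4 / 3 * t := by
  have h1 := o.h_le hu {v} (by simpa using hv) (by simpa using huv)
  have h2 := o.h_le hv {u} (by simpa using hu) (by simpa using s.h_symm huv)
  simp at h1 h2
  linarith

lemma Opt.small (o : s.Opt x S t) (h6 : S.card ≤ 6) : S.card = 6 ∧ s.FullK S := by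
  classical
  have hc := o.card_le S subset_rfl
  have ht := o.lt
  have htp := o.t_pos
  rw [o.sum] at hc
  have hcard : S.card = 6 := by
    by_contra hne
    have : (S.card : ℝ) ≤ 5 := by
      have : S.card ≤ 5 := by omega
      exact_mod_cast this
    nlinarith
  refine ⟨hcard, ?_⟩
  intro u hu v hv huv
  rcases o.nz u hu v hv huv with h | h
  · exact h
  · exfalso
    have h1 := o.hpair hu hv h
    have hv' : v ∈ S.erase u := mem_erase.2 ⟨huv.symm, hv⟩
    have h2 := add_sum_erase S x hu
    have h3 := add_sum_erase (S.erase u) x hv'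
    have h4 := o.card_le ((S.erase u).erase v) ((erase_subset _ _).trans (erase_subset _ _))
    rw [card_erase_of_mem hv', card_erase_of_mem hu, hcard, ] at h4
    rw [o.sum] at h2
    norm_num at h4
    linarith

open Classical in
lemma Opt.fulldeg (o : s.Opt x S t) {v : ι} (hv : v ∈ S) :
    ∑ u ∈ S.filter (s.full v), x u = 1 - 2 * t + x v := by
  have h1 := o.eq v hv
  have h2 : S = (insert v (S.filter (s.h v))) ∪ S.filter (s.full v) := by
    ext u
    simp only [mem_union, mem_insert, mem_filter]
    constructor
    · intro hu
      by_cases huv : v = u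
      · exact Or.inl (Or.inl huv.symm)
      · rcases o.nz v hv u hu huv with h | h
        · exact Or.inr ⟨hu, h⟩
        · exact Or.inl (Or.inr ⟨hu, h⟩)
    · rintro ((rfl | h) | h)
      · exact hv
      · exact h.1
      · exact h.1
  have h3 : Disjoint (insert v (S.filter (s.h v))) (S.filter (s.full v)) := by
    rw [disjoint_left]
    intro u hu hu'
    rw [mem_filter] at hu'
    rw [mem_insert, mem_filter] at hu
    rcases hu with rfl | hu
    · exact s.full_irr _ hu'.2
    · exact hu.2.2 hu'.2
  have h4 := o.sum
  rw [h2, sum_union h3, sum_insert (by simp [h, s.bl_irr])] at h4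
  linarith

/-- elements of S of blue type -/
lemma nonred_h (hS : s.NZ S) {u v : ι} (hu : u ∈ S) (hv : v ∈ S) (huv : u ≠ v) (h1 : ¬ s.R u)
    (h2 : ¬ s.R v) (hr : ¬ s.red u v) (hf : ¬ s.fb u v) : s.h u v := by
  rcases hS u hu v hv huv with (a | a | a) | a
  · exact absurd a hr
  · exact absurd a hf
  · rcases a.2 with b | b <;> contradiction
  · exact a

lemma Opt.sub_sum (o : s.Opt x S t) {A B : Finset ι} (hB : B ⊆ S) (hAB : A ⊆ B) :
    ∑ v ∈ A, x v ≤ ∑ v ∈ B, x v :=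
  sum_le_sum_of_subset_of_nonneg hAB fun i hi _ => (o.pos i (hB hi)).le

open Classical in
lemma Opt.union_sum (o : s.Opt x S t) {A B : Finset ι} (hA : A ⊆ S) (_ : B ⊆ S) :
    ∑ v ∈ A ∪ B, x v ≤ ∑ v ∈ A, x v + ∑ v ∈ B, x v := by
  have := sum_union_inter (s₁ := A) (s₂ := B) (f := x)
  have h2 : 0 ≤ ∑ v ∈ A ∩ B, x v :=
    sum_nonneg fun i hi => (o.pos i (hA (mem_inter.1 hi).1)).le
  linarith

open Classical in
/-- red neighbourhood is a blue clique -/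
lemma nred_pair {v : ι} : ∀ a ∈ S.filter (s.red v), ∀ b ∈ S.filter (s.red v), ¬ s.red a b := by
  intro a ha b hb hab
  rw [mem_filter] at ha hb
  exact s.red_tri v a b ha.2 hab hb.2

open Classical in
lemma nred_nR {v : ι} : ∀ a ∈ S.filter (s.red v), a ∈ S ∧ ¬ s.R a := by
  intro a ha
  rw [mem_filter] at ha
  exact ⟨ha.1, fun h => s.red_R _ _ h (s.red_symm _ _ ha.2)⟩

open Classical in
lemma Opt.case_ge3 (o : s.Opt x S t) (hr : 3 ≤ (S.filter s.R).card) : S.card ≤ 6 := by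
  have hsplit : (S.filter s.R).card + (S.filter (fun u => ¬ s.R u)).card = S.card :=
    card_filter_add_card_filter_not _
  have hr5 : (S.filter s.R).card ≤ 5 := by
    simpa using cap o.nz [] [] (by simp) (by simp) (by simp) (by simp) (by simp)
  by_contra hc
  have : 2 ≤ (S.filter (fun u => ¬ s.R u)).card := by omega
  obtain ⟨u, hu, v, hv, huv⟩ := one_lt_card.1 (show 1 < _ from this)
  simp only [mem_filter] at hu hv
  have h3 := cap o.nz [] [u] (by simp) (by simp) (by simp) (by simp [hu]) (by simp)
  simp at h3
  have h3 : 2 < (S.filter (fun u => ¬ s.R u)).card := by omega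
  obtain ⟨a, ha, b, hb, c, hc, hab, hac, hbc⟩ := two_lt_card.1 h3
  have key : ∀ a ∈ S.filter (fun u => ¬ s.R u), ∀ b ∈ S.filter (fun u => ¬ s.R u), a ≠ b → s.red a b := by
    intro a ha b hb hab
    by_contra hn
    rw [mem_filter] at ha hb
    have hb' := o.nz.red_or_bl ha.1 hb.1 hab hn
    have := cap o.nz [a] [b] (by simp) (by simp) (by simp [ha]) (by simp [hb]) (by simpa using hb')
    simp only [List.length_cons, List.length_nil] at this; omega
  exact s.red_tri _ _ _ (key a ha b hb hab) (key b hb c hc hbc) (key a ha c hc hac)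

open Classical in
lemma Opt.case_2 (o : s.Opt x S t) (hr : (S.filter s.R).card = 2) : S.card ≤ 6 := by
  exfalso
  have hsplit : (S.filter s.R).card + (S.filter (fun u => ¬ s.R u)).card = S.card :=
    card_filter_add_card_filter_not _
  have ht := o.lt
  have htp := o.t_pos
  by_cases hB : S.filter (fun u => ¬ s.R u) = ∅
  · rw [hB, hr] at hsplit
    have := o.card_le S subset_rfl
    rw [o.sum, ← hsplit] at this
    simp at this; linarith
  obtain ⟨v, hv⟩ := nonempty_iff_ne_empty.2 hB
  rw [mem_filter] at hv
  have hnf : ∀ u ∈ S, ∀ v ∈ S, ¬ s.R u → ¬ s.R v → ¬ s.fb u v := by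
    intro u hu v hv hu' hv' hf
    have := cap o.nz [] [u, v] (by simp) (by simpa using hf) (by simp) (by simp [hu, hv, hu', hv']) (by simp)
    simp at this; omega
  have hdeg := o.fulldeg hv.1
  have hsub : S.filter (s.full v) ⊆ S.filter s.R ∪ S.filter (s.red v) := by
    intro u hu
    rw [mem_filter] at hu
    rw [mem_union, mem_filter, mem_filter]
    rcases hu.2 with h | h | h
    · exact Or.inr ⟨hu.1, h⟩
    · by_cases hR : s.R u
      · exact Or.inl ⟨hu.1, hR⟩
      · exact absurd h (hnf v hv.1 u hu.1 hv.2 hR)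
    · exact Or.inl ⟨hu.1, h.2.resolve_left hv.2⟩
  have h1 := o.sub_sum (union_subset (filter_subset _ _) (filter_subset _ _)) hsub
  have h2 := o.union_sum (filter_subset s.R S) (filter_subset (s.red v) S)
  have h3 := o.card_le _ (filter_subset s.R S)
  rw [hr] at h3
  have hblq : ∀ a ∈ S.filter (s.red v), ∀ b ∈ S.filter (s.red v), a ≠ b → s.h a b := by
    intro a ha b hb hab
    exact nonred_h o.nz (nred_nR a ha).1 (nred_nR b hb).1 hab (nred_nR a ha).2 (nred_nR b hb).2
      (nred_pair a ha b hb) (hnf _ (nred_nR a ha).1 _ (nred_nR b hb).1 (nred_nR a ha).2 (nred_nR b hb).2)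
  have h4 := o.hclique _ (filter_subset (s.red v) S) hblq
  have h5 : (S.filter (s.red v)).card ≤ 2 := by
    rcases (S.filter (s.red v)).eq_empty_or_nonempty with h | h
    · simp [h]
    · have := capT o.nz _ nred_nR (fun a ha b hb hab => (hblq a ha b hb hab).1) h
      omega
  have hxv := o.pos v hv.1
  have h6 : ∑ u ∈ S.filter (s.red v), x u ≤ 4 / 3 * t := by
    generalize (S.filter (s.red v)).card = k at *
    interval_cases k <;> norm_num at h4 <;> linarith
  push_cast at h3
  linarith

open Classical in
lemma Opt.bc1 (o : s.Opt x S t) (hr : (S.filter s.R).card = 1) (T : Finset ι)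
    (hTS : ∀ a ∈ T, a ∈ S ∧ ¬ s.R a) (hT : ∀ a ∈ T, ∀ b ∈ T, ¬ s.red a b) :
    T.card ≤ 3 ∧ ∑ v ∈ T, x v ≤ 2 * t ∧ (∑ v ∈ T, x v ≤ 3 / 2 * t ∨ T.card = 2) := by
  have htp := o.t_pos
  have hbl : ∀ a ∈ T, ∀ b ∈ T, a ≠ b → s.bl a b := fun a ha b hb hab =>
    o.nz.red_or_bl (hTS a ha).1 (hTS b hb).1 hab (hT a ha b hb)
  rcases T.eq_empty_or_nonempty with h | h
  · subst h; simp; exact htp.le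
  have hc := capT o.nz T hTS hbl h
  have hsub : T ⊆ S := fun a ha => (hTS a ha).1
  have h1 := o.card_le T hsub
  rcases (show T.card ≤ 1 ∨ T.card = 2 ∨ T.card = 3 by omega) with h' | h' | h'
  · have : (T.card : ℝ) ≤ 1 := by exact_mod_cast h'
    refine ⟨by omega, ?_, Or.inl ?_⟩ <;> nlinarith
  · rw [h'] at h1
    exact ⟨by omega, by exact_mod_cast h1, Or.inr h'⟩
  · have hh : ∀ a ∈ T, ∀ b ∈ T, a ≠ b → s.h a b := by
      intro a ha b hb hab
      refine nonred_h o.nz (hTS a ha).1 (hTS b hb).1 hab (hTS a ha).2 (hTS b hb).2 (hT a ha b hb) ?_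
      intro hf
      obtain ⟨c, hc, hca, hcb⟩ : ∃ c ∈ T, c ≠ a ∧ c ≠ b := by
        have : 0 < ((T.erase a).erase b).card := by
          rw [card_erase_of_mem (mem_erase.2 ⟨hab.symm, hb⟩), card_erase_of_mem ha]; omega
        obtain ⟨c, hc⟩ := card_pos.1 this
        simp only [mem_erase] at hc
        exact ⟨c, hc.2.2, hc.2.1, hc.1⟩
      have := cap o.nz [c] [a, b] (by simp) (by simpa using hf) (by simpa using hTS c hc)
        (by simp [(hTS a ha).2, (hTS b hb).2]; exact ⟨hsub ha, hsub hb⟩)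
        (by simp; exact ⟨hbl c hc a ha hca, hbl c hc b hb hcb⟩)
      simp only [List.length_cons, List.length_nil] at this; omega
    have := o.hclique T hsub hh
    rw [h'] at this
    norm_num at this
    refine ⟨by omega, by linarith, Or.inl (by linarith)⟩

open Classical in
lemma Opt.case_1 (o : s.Opt x S t) (hr : (S.filter s.R).card = 1) : S.card ≤ 6 := by
  have hsplit : (S.filter s.R).card + (S.filter (fun u => ¬ s.R u)).card = S.card :=
    card_filter_add_card_filter_not _
  have ht := o.lt
  have htp := o.t_pos
  by_cases hB : S.filter (fun u => ¬ s.R u) = ∅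
  · rw [hB, hr] at hsplit
    simp at hsplit; omega
  obtain ⟨v, hv⟩ := nonempty_iff_ne_empty.2 hB
  rw [mem_filter] at hv
  have h3 := o.card_le _ (filter_subset s.R S)
  rw [hr] at h3
  push_cast at h3
  obtain ⟨N1, N2, N3⟩ := o.bc1 hr (S.filter (s.red v)) nred_nR nred_pair
  by_cases hf : ∃ u ∈ S, ¬ s.R u ∧ s.fb v u ∧ ¬ s.red v u
  · obtain ⟨u, hu, huR, hfb, hnr⟩ := hf
    have hvu : v ≠ u := by rintro rfl; exact s.bl_irr _ (s.fb_bl _ _ hfb)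
    set D := insert v (S.filter fun z => ¬ s.R z ∧ z ≠ u ∧ z ≠ v ∧ ¬ s.red v z) with hD
    have hDS : ∀ a ∈ D, a ∈ S ∧ ¬ s.R a := by
      intro a ha
      rw [hD, mem_insert, mem_filter] at ha
      rcases ha with rfl | ha
      · exact hv
      · exact ⟨ha.1, ha.2.1⟩
    have hured : ∀ a ∈ D, a ≠ v → s.red u a := by
      intro a ha hav
      rw [hD, mem_insert, mem_filter] at ha
      have ha := ha.resolve_left hav
      by_contra hn
      have b1 := o.nz.red_or_bl hu ha.1 ha.2.2.1.symm hn
      have b2 := o.nz.red_or_bl hv.1 ha.1 hav.symm ha.2.2.2.2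
      have := cap o.nz [a] [v, u] (by simp) (by simpa using hfb) (by simp [ha.1, ha.2.1])
        (by simp [hv, hu, huR]) (by simp; exact ⟨s.bl_symm _ _ b2, s.bl_symm _ _ b1⟩)
      simp only [List.length_cons, List.length_nil] at this; omega
    have hDp : ∀ a ∈ D, ∀ b ∈ D, ¬ s.red a b := by
      intro a ha b hb hab
      have e1 : ∀ a ∈ D, ¬ s.red v a := by
        intro a ha
        rw [hD, mem_insert, mem_filter] at ha
        rcases ha with rfl | ha
        · exact s.red_irr _
        · exact ha.2.2.2.2
      by_cases hav : a = v
      · subst hav; exact e1 b hb hab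
      by_cases hbv : b = v
      · subst hbv; exact e1 a ha (s.red_symm _ _ hab)
      exact s.red_tri u a b (hured a ha hav) hab (hured b hb hbv)
    obtain ⟨D1, D2, D3⟩ := o.bc1 hr D hDS hDp
    have hcov : S ⊆ S.filter s.R ∪ ({u} ∪ (D ∪ S.filter (s.red v))) := by
      intro z hz
      by_cases h1 : s.R z
      · exact mem_union_left _ (mem_filter.2 ⟨hz, h1⟩)
      refine mem_union_right _ ?_
      by_cases h2 : z = u
      · exact mem_union_left _ (mem_singleton.2 h2)
      refine mem_union_right _ ?_
      by_cases h3 : s.red v z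
      · exact mem_union_right _ (mem_filter.2 ⟨hz, h3⟩)
      refine mem_union_left _ ?_
      rw [hD, mem_insert, mem_filter]
      by_cases h4 : z = v
      · exact Or.inl h4
      · exact Or.inr ⟨hz, h1, h2, h4, h3⟩
    have hDsub : D ⊆ S := fun a ha => (hDS a ha).1
    have s1 : {u} ⊆ S := by simpa using hu
    have s2 := filter_subset (s.red v) S
    have s3 := filter_subset s.R S
    have q1 := o.sub_sum (union_subset s3 (union_subset s1 (union_subset hDsub s2))) hcov
    have q2 := o.union_sum s3 (union_subset s1 (union_subset hDsub s2))
    have q3 := o.union_sum s1 (union_subset hDsub s2)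
    have q4 := o.union_sum hDsub s2
    have q5 := o.le_t hu
    rw [sum_singleton] at q3
    rw [o.sum] at q1
    rcases D3 with D3 | D3
    · linarith
    rcases N3 with N3 | N3
    · linarith
    have c1 := card_le_card hcov
    have c2 := card_union_le (S.filter s.R) ({u} ∪ (D ∪ S.filter (s.red v)))
    have c3 := card_union_le {u} (D ∪ S.filter (s.red v))
    have c4 := card_union_le D (S.filter (s.red v))
    rw [card_singleton] at c3
    omega
  · exfalso
    push Not at hf
    have hdeg := o.fulldeg hv.1
    have hsub : S.filter (s.full v) ⊆ S.filter s.R ∪ S.filter (s.red v) := by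
      intro u hu
      rw [mem_filter] at hu
      rw [mem_union, mem_filter, mem_filter]
      by_cases hR : s.R u
      · exact Or.inl ⟨hu.1, hR⟩
      right
      rcases hu.2 with h | h | h
      · exact ⟨hu.1, h⟩
      · exact ⟨hu.1, hf u hu.1 hR h⟩
      · exact absurd h.2 (by simp [hv.2, hR])
    have h1 := o.sub_sum (union_subset (filter_subset _ _) (filter_subset _ _)) hsub
    have h2 := o.union_sum (filter_subset s.R S) (filter_subset (s.red v) S)
    have hxv := o.pos v hv.1
    linarith

end Sys
end RT36

end

section

open Finset

namespace RT36
namespace Sys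
set_option linter.unusedSectionVars false
variable {ι : Type*} [Fintype ι] {s : Sys ι} {x : ι → ℝ} {S : Finset ι} {t : ℝ}

section zero

open Classical in
lemma Opt.nf3 (o : s.Opt x S t) {a b c : ι} (ha : a ∈ S ∧ ¬ s.R a) (hb : b ∈ S ∧ ¬ s.R b)
    (hc : c ∈ S ∧ ¬ s.R c) (h1 : s.fb a b) (h2 : s.fb b c) (h3 : s.fb a c) : False := by
  have := cap o.nz [] [a, b, c] (by simp) (by simp; exact ⟨⟨h1, h3⟩, h2⟩) (by simp)
    (by simp; exact ⟨ha, hb, hc⟩) (by simp)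
  simp at this

open Classical in
lemma Opt.nf4 (o : s.Opt x S t) {a b c d : ι} (ha : a ∈ S ∧ ¬ s.R a) (hb : b ∈ S ∧ ¬ s.R b)
    (hc : c ∈ S ∧ ¬ s.R c) (hd : d ∈ S ∧ ¬ s.R d) (h1 : s.fb a b) (h2 : s.bl c d)
    (h3 : s.bl a c) (h4 : s.bl a d) (h5 : s.bl b c) (h6 : s.bl b d) : False := by
  have := cap o.nz [c, d] [a, b] (by simpa using h2) (by simpa using h1)
    (by simp; exact ⟨hc, hd⟩) (by simp; exact ⟨ha, hb⟩)
    (by simp; exact ⟨⟨s.bl_symm _ _ h3, s.bl_symm _ _ h5⟩, s.bl_symm _ _ h4, s.bl_symm _ _ h6⟩)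
  simp at this

open Classical in
/-- blue cliques, r = 0 -/
lemma Opt.bc0 (o : s.Opt x S t) (T : Finset ι)
    (hTS : ∀ a ∈ T, a ∈ S ∧ ¬ s.R a) (hT : ∀ a ∈ T, ∀ b ∈ T, ¬ s.red a b) :
    T.card ≤ 4 ∧ ∑ v ∈ T, x v ≤ 3 * t := by
  have htp := o.t_pos
  have hbl : ∀ a ∈ T, ∀ b ∈ T, a ≠ b → s.bl a b := fun a ha b hb hab =>
    o.nz.red_or_bl (hTS a ha).1 (hTS b hb).1 hab (hT a ha b hb)
  rcases T.eq_empty_or_nonempty with h | h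
  · subst h; simp; exact htp.le
  have hc := capT o.nz T hTS hbl h
  have hsub : T ⊆ S := fun a ha => (hTS a ha).1
  have h1 := o.card_le T hsub
  refine ⟨by omega, ?_⟩
  rcases (show T.card ≤ 3 ∨ T.card = 4 by omega) with h' | h'
  · have : (T.card : ℝ) ≤ 3 := by exact_mod_cast h'
    nlinarith
  · have hh : ∀ a ∈ T, ∀ b ∈ T, a ≠ b → s.h a b := by
      intro a ha b hb hab
      refine nonred_h o.nz (hTS a ha).1 (hTS b hb).1 hab (hTS a ha).2 (hTS b hb).2 (hT a ha b hb) ?_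
      intro hf
      have : 1 < ((T.erase a).erase b).card := by
        rw [card_erase_of_mem (mem_erase.2 ⟨hab.symm, hb⟩), card_erase_of_mem ha]; omega
      obtain ⟨c, hc, d, hd, hcd⟩ := one_lt_card.1 this
      simp only [mem_erase] at hc hd
      exact o.nf4 (hTS a ha) (hTS b hb) (hTS c hc.2.2) (hTS d hd.2.2) hf
        (hbl c hc.2.2 d hd.2.2 hcd) (hbl a ha c hc.2.2 hc.2.1.symm) (hbl a ha d hd.2.2 hd.2.1.symm)
        (hbl b hb c hc.2.2 hc.1.symm) (hbl b hb d hd.2.2 hd.1.symm)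
    have := o.hclique T hsub hh
    rw [h'] at this
    norm_num at this
    linarith

open Classical in
lemma Opt.card11 (o : s.Opt x S t) (hR : ∀ a ∈ S, ¬ s.R a) : S.card ≤ 11 := by
  have ht := o.lt
  have htp := o.t_pos
  have hm : ∀ a, a ∈ S → a ∈ S ∧ ¬ s.R a := fun a ha => ⟨ha, hR a ha⟩
  obtain ⟨v, hv⟩ : S.Nonempty := by
    by_contra h
    rw [not_nonempty_iff_eq_empty] at h
    have := o.sum
    simp [h] at this
  obtain ⟨N1, N2⟩ := o.bc0 (S.filter (s.red v)) nred_nR nred_pair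
  by_cases hf : ∃ u ∈ S, s.fb v u ∧ ¬ s.red v u
  · obtain ⟨u, hu, hfb, hnr⟩ := hf
    have hvu : v ≠ u := by rintro rfl; exact s.bl_irr _ (s.fb_bl _ _ hfb)
    set D := insert v (S.filter fun z => z ≠ u ∧ z ≠ v ∧ ¬ s.red v z ∧ s.red u z) with hD
    set C := S.filter fun z => z ≠ u ∧ z ≠ v ∧ ¬ s.red v z ∧ ¬ s.red u z with hC
    have hDS : ∀ a ∈ D, a ∈ S ∧ ¬ s.R a := by
      intro a ha
      rw [hD, mem_insert, mem_filter] at ha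
      rcases ha with rfl | ha
      · exact hm _ hv
      · exact hm _ ha.1
    have hDp : ∀ a ∈ D, ∀ b ∈ D, ¬ s.red a b := by
      intro a ha b hb hab
      have e1 : ∀ a ∈ D, ¬ s.red v a := by
        intro a ha
        rw [hD, mem_insert, mem_filter] at ha
        rcases ha with rfl | ha
        · exact s.red_irr _
        · exact ha.2.2.2.1
      by_cases hav : a = v
      · subst hav; exact e1 b hb hab
      by_cases hbv : b = v
      · subst hbv; exact e1 a ha (s.red_symm _ _ hab)
      rw [hD, mem_insert, mem_filter] at ha hb
      exact s.red_tri u a b (ha.resolve_left hav).2.2.2.2 hab (hb.resolve_left hbv).2.2.2.2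
    obtain ⟨D1, -⟩ := o.bc0 D hDS hDp
    have hCc : C.card ≤ 2 := by
      by_contra hcon
      obtain ⟨a, ha, b, hb, c, hc, hab, hac, hbc⟩ := two_lt_card.1 (not_le.1 hcon)
      have key : ∀ a ∈ C, ∀ b ∈ C, a ≠ b → s.red a b := by
        intro a ha b hb hab
        by_contra hn
        rw [hC, mem_filter] at ha hb
        exact o.nf4 (hm _ hv) (hm _ hu) (hm _ ha.1) (hm _ hb.1) hfb
          (o.nz.red_or_bl ha.1 hb.1 hab hn)
          (o.nz.red_or_bl hv ha.1 ha.2.2.1.symm ha.2.2.2.1)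
          (o.nz.red_or_bl hv hb.1 hb.2.2.1.symm hb.2.2.2.1)
          (o.nz.red_or_bl hu ha.1 ha.2.1.symm ha.2.2.2.2)
          (o.nz.red_or_bl hu hb.1 hb.2.1.symm hb.2.2.2.2)
      exact s.red_tri _ _ _ (key a ha b hb hab) (key b hb c hc hbc) (key a ha c hc hac)
    have hcov : S ⊆ C ∪ ({u} ∪ (D ∪ S.filter (s.red v))) := by
      intro z hz
      simp only [hC, hD, mem_union, mem_filter, mem_insert, mem_singleton]
      tauto
    have c1 := card_le_card hcov
    have c2 := card_union_le C ({u} ∪ (D ∪ S.filter (s.red v)))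
    have c3 := card_union_le {u} (D ∪ S.filter (s.red v))
    have c4 := card_union_le D (S.filter (s.red v))
    rw [card_singleton] at c3
    omega
  · exfalso
    push Not at hf
    have hdeg := o.fulldeg hv
    have hsub : S.filter (s.full v) ⊆ S.filter (s.red v) := by
      intro u hu
      rw [mem_filter] at hu ⊢
      rcases hu.2 with h | h | h
      · exact ⟨hu.1, h⟩
      · exact ⟨hu.1, hf u hu.1 h⟩
      · exact absurd h.2 (by simp [hR v hv, hR u hu.1])
    have h1 := o.sub_sum (filter_subset _ _) hsub
    have hxv := o.pos v hv
    linarith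

open Classical in
lemma motzkin (p : ι → ι → Prop) (hp : ∀ a b, p a b → p b a) (hirr : ∀ a, ¬ p a a)
    (hk : ∀ C : Finset ι, (∀ a ∈ C, ∀ b ∈ C, a ≠ b → p a b) → C.card ≤ 4)
    (q : ι → ℝ) (hq : ∀ i, 0 ≤ q i) (hq1 : ∑ i, q i = 1) :
    quad (fun a b => if p a b then (1 : ℝ) else 0) q ≤ 3 / 4 := by
  obtain ⟨y, hy0, hy1, -, hle, hlin, hne⟩ := lagrange (fun a b => if p a b then (1 : ℝ) else 0)
    (fun i j => by
      by_cases h : p i j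
      · simp [h, hp _ _ h]
      · have : ¬ p j i := fun h' => h (hp _ _ h')
        simp [h, this]) (fun i => by simp [hirr]) q hq hq1
  refine hle.trans ?_
  set L := quad (fun a b => if p a b then (1 : ℝ) else 0) y with hL
  set C := univ.filter fun i => 0 < y i with hC
  have hCc : C.card ≤ 4 := by
    apply hk
    intro a ha b hb hab
    rw [hC, mem_filter] at ha hb
    have := hne a b hab ha.2 hb.2
    by_contra hn
    simp [hn] at this
  have hoff : ∀ i, i ∉ C → y i = 0 := by
    intro i hi
    have := hy0 i
    by_contra h
    exact hi (mem_filter.2 ⟨mem_univ _, lt_of_le_of_ne this (Ne.symm h)⟩)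
  have hsC : ∑ i ∈ C, y i = 1 := by
    rw [← hy1]
    exact sum_subset (subset_univ _) fun i _ hi => hoff i hi
  have hv : ∀ v ∈ C, 1 - y v = L := by
    intro v hvC
    have h1 := hlin v (mem_filter.1 hvC).2
    have h2 := add_sum_erase C y hvC
    rw [hsC] at h2
    have h3 : 1 - y v = ∑ j ∈ C.erase v, y j := by linarith
    rw [← h1, h3]
    unfold lin
    rw [← sum_subset (subset_univ (C.erase v))]
    · refine sum_congr rfl fun j hj => ?_
      rw [mem_erase] at hj
      have := hne v j hj.1.symm (mem_filter.1 hvC).2 (mem_filter.1 hj.2).2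
      simp at this
      simp [this]
    · intro j _ hj
      rw [mem_erase, not_and_or, not_not] at hj
      rcases hj with rfl | hj
      · simp [hirr]
      · rw [hoff j hj]; simp
  have hsum : ∑ v ∈ C, (1 - L) = 1 := by
    rw [← hsC]
    exact sum_congr rfl fun v hvC => by linarith [hv v hvC]
  rw [sum_const, nsmul_eq_mul] at hsum
  have h4 : (C.card : ℝ) ≤ 4 := by exact_mod_cast hCc
  by_contra hcon
  push Not at hcon
  have h0 : (0 : ℝ) ≤ C.card := Nat.cast_nonneg _
  rcases le_or_gt L 1 with hL1 | hL1
  · have := mul_le_mul_of_nonneg_right h4 (sub_nonneg.2 hL1)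
    linarith
  · have := mul_nonneg h0 (sub_nonneg.2 hL1.le)
    linarith

open Classical in
lemma Opt.exists5 (o : s.Opt x S t) (hx : ∀ i, i ∉ S → x i = 0) (hR : ∀ a ∈ S, ¬ s.R a) :
    ∃ I ⊆ S, I.card = 5 ∧ s.FullK I := by
  by_contra hcon
  push Not at hcon
  have hx0 : ∀ i, 0 ≤ x i := by
    intro i
    by_cases h : i ∈ S
    · exact (o.pos i h).le
    · rw [hx i h]
  have hx1 : ∑ i, x i = 1 := by
    rw [← o.sum]
    exact (sum_subset (subset_univ _) fun i _ hi => hx i hi).symm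
  have := motzkin (fun a b => a ∈ S ∧ b ∈ S ∧ s.full a b) (fun a b h => ⟨h.2.1, h.1, s.full_symm h.2.2⟩)
    (fun a h => s.full_irr _ h.2.2) ?_ x hx0 hx1
  · rw [quad_eq_lin] at this
    have e : ∑ i, x i * lin (fun a b => if a ∈ S ∧ b ∈ S ∧ s.full a b then (1 : ℝ) else 0) x i
        = ∑ i ∈ S, x i * (1 - 2 * t + x i) := by
      rw [← sum_subset (subset_univ S) (fun i _ hi => by rw [hx i hi, zero_mul])]
      refine sum_congr rfl fun i hi => ?_
      rw [← o.fulldeg hi]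
      unfold lin
      congr 1
      rw [sum_filter, ← sum_subset (subset_univ S) (fun i _ hi => by rw [hx i hi, mul_zero])]
      refine sum_congr rfl fun j hj => ?_
      simp [hi, hj]
    replace this : ∑ i ∈ S, x i * (1 - 2 * t + x i) ≤ 3 / 4 := by
      rw [← e]
      convert this
    have e2 : ∑ i ∈ S, x i * (1 - 2 * t + x i) = (1 - 2 * t) + ∑ i ∈ S, x i ^ 2 := by
      have : ∀ i ∈ S, x i * (1 - 2 * t + x i) = (1 - 2 * t) * x i + x i ^ 2 := fun i _ => by ring
      rw [sum_congr rfl this, sum_add_distrib, ← mul_sum, o.sum, mul_one]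
    rw [e2] at this
    have cs := sq_sum_le_card_mul_sum_sq (s := S) (f := x)
    rw [o.sum] at cs
    have h11 : (S.card : ℝ) ≤ 11 := by exact_mod_cast o.card11 hR
    have hn : 0 ≤ ∑ i ∈ S, x i ^ 2 := sum_nonneg fun i _ => sq_nonneg _
    have := o.lt
    nlinarith
  · intro C hC
    by_contra h5
    obtain ⟨I, hIC, hI5⟩ := exists_subset_card_eq (show 5 ≤ C.card by omega)
    refine hcon I ?_ hI5 ?_
    · intro a ha
      have : (C.erase a).Nonempty := card_pos.1 (by rw [card_erase_of_mem (hIC ha)]; omega)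
      obtain ⟨b, hb⟩ := this
      rw [mem_erase] at hb
      exact (hC a (hIC ha) b hb.2 hb.1.symm).1
    · intro a ha b hb hab
      exact (hC a (hIC ha) b (hIC hb) hab).2.2

open Classical in
lemma Opt.k5deg (o : s.Opt x S t) (hR : ∀ a ∈ S, ¬ s.R a) {I : Finset ι} (hIS : I ⊆ S)
    (h5 : I.card = 5) (hI : s.FullK I) {a : ι} (ha : a ∈ I) : (I.filter (s.red a)).card = 2 := by
  have hm : ∀ a, a ∈ I → a ∈ S ∧ ¬ s.R a := fun a ha => ⟨hIS ha, hR a (hIS ha)⟩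
  have hc : ((I.erase a).filter (s.red a)).card + ((I.erase a).filter (fun u => ¬ s.red a u)).card
      = (I.erase a).card := card_filter_add_card_filter_not _
  rw [card_erase_of_mem ha, h5] at hc
  have e : (I.erase a).filter (s.red a) = I.filter (s.red a) := by
    ext u
    simp only [mem_filter, mem_erase]
    constructor
    · exact fun h => ⟨h.1.2, h.2⟩
    · exact fun h => ⟨⟨by rintro rfl; exact s.red_irr _ h.2, h.1⟩, h.2⟩
  have fb := fun {u v : ι} (hu : u ∈ I) (hv : v ∈ I) huv hr => hI.fb (u := u) (v := v) hu hv huv hr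
    (hm u hu).2 (hm v hv).2
  have h1 : (I.filter (s.red a)).card ≤ 2 := by
    by_contra hcon
    obtain ⟨b, hb, c, hc, d, hd, hbc, hbd, hcd⟩ := two_lt_card.1 (not_le.1 hcon)
    have n1 := nred_pair b hb c hc
    have n2 := nred_pair c hc d hd
    have n3 := nred_pair b hb d hd
    rw [mem_filter] at hb hc hd
    exact o.nf3 (hm _ hb.1) (hm _ hc.1) (hm _ hd.1) (fb hb.1 hc.1 hbc n1) (fb hc.1 hd.1 hcd n2)
      (fb hb.1 hd.1 hbd n3)
  have h2 : ((I.erase a).filter (fun u => ¬ s.red a u)).card ≤ 2 := by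
    by_contra hcon
    obtain ⟨b, hb, c, hc, d, hd, hbc, hbd, hcd⟩ := two_lt_card.1 (not_le.1 hcon)
    have key : ∀ b ∈ (I.erase a).filter (fun u => ¬ s.red a u),
        ∀ c ∈ (I.erase a).filter (fun u => ¬ s.red a u), b ≠ c → s.red b c := by
      intro b hb c hc hbc
      by_contra hn
      simp only [mem_filter, mem_erase] at hb hc
      exact o.nf3 (hm _ ha) (hm _ hb.1.2) (hm _ hc.1.2) (fb ha hb.1.2 hb.1.1.symm hb.2)
        (fb hb.1.2 hc.1.2 hbc hn) (fb ha hc.1.2 hc.1.1.symm hc.2)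
    exact s.red_tri _ _ _ (key b hb c hc hbc) (key c hc d hd hcd) (key b hb d hd hbd)
  rw [e] at hc
  omega

open Classical in
lemma Opt.case_0 (o : s.Opt x S t) (hx : ∀ i, i ∉ S → x i = 0) (hR : ∀ a ∈ S, ¬ s.R a) :
    ∃ C ⊆ S, C.card = 6 ∧ s.FullK C := by
  by_contra hcon
  push Not at hcon
  have ht := o.lt
  have htp := o.t_pos
  have hm : ∀ a, a ∈ S → a ∈ S ∧ ¬ s.R a := fun a ha => ⟨ha, hR a ha⟩
  obtain ⟨I0, hI0S, hI05, hI0⟩ := o.exists5 hx hR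
  obtain ⟨I, hImem, hImax⟩ := exists_max_image
    ((S.powersetCard 5).filter fun I => s.FullK I) (fun I => ∑ v ∈ I, x v)
    ⟨I0, by simp [mem_powersetCard, hI0S, hI05, hI0]⟩
  simp only [mem_filter, mem_powersetCard] at hImem hImax
  obtain ⟨⟨hIS, hI5⟩, hI⟩ := hImem
  set k : ι → ℕ := fun v => (I.filter (s.h v)).card with hk
  -- every outside vertex has a half neighbour
  have hk1 : ∀ v ∈ S \ I, 1 ≤ k v := by
    intro v hv
    rw [mem_sdiff] at hv
    by_contra h0
    have h0 : I.filter (s.h v) = ∅ := by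
      rw [← card_eq_zero]; simp only [hk] at h0; omega
    rw [filter_eq_empty_iff] at h0
    have key : ∀ a ∈ I, s.full v a := fun a ha =>
      (o.nz v hv.1 a (hIS ha) (by rintro rfl; exact hv.2 ha)).resolve_right (h0 ha)
    refine hcon (insert v I) (insert_subset hv.1 hIS) (by rw [card_insert_of_notMem hv.2, hI5]) ?_
    intro a ha b hb hab
    rw [mem_insert] at ha hb
    rcases ha with rfl | ha
    · rcases hb with rfl | hb
      · exact absurd rfl hab
      · exact key b hb
    · rcases hb with rfl | hb
      · exact s.full_symm (key a ha)
      · exact hI a ha b hb hab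
  set A := (S \ I).filter fun v => k v = 1 with hA
  -- each v in A is a clone of its half-neighbour
  have hclone : ∀ v ∈ A, ∃ i ∈ I, s.h v i ∧ (∀ a ∈ I, a ≠ i → s.full v a) ∧
      (∀ a ∈ I, a ≠ i → (s.red a v ↔ s.red a i)) ∧ x v ≤ 2 / 3 * t := by
    intro v hv
    rw [hA, mem_filter, mem_sdiff] at hv
    obtain ⟨⟨hvS, hvI⟩, hkv⟩ := hv
    obtain ⟨i, hi⟩ := card_eq_one.1 hkv
    have himem : i ∈ I.filter (s.h v) := by rw [hi]; simp
    rw [mem_filter] at himem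
    have hfull : ∀ a ∈ I, a ≠ i → s.full v a := by
      intro a ha hai
      refine (o.nz v hvS a (hIS ha) (by rintro rfl; exact hvI ha)).resolve_right fun hh => hai ?_
      have : a ∈ I.filter (s.h v) := mem_filter.2 ⟨ha, hh⟩
      rw [hi] at this
      simpa using this
    have hve : v ∉ I.erase i := fun h => hvI (mem_of_mem_erase h)
    have hJ5 : (insert v (I.erase i)).card = 5 := by
      rw [card_insert_of_notMem hve, card_erase_of_mem himem.1, hI5]
    have hJS : insert v (I.erase i) ⊆ S := insert_subset hvS ((erase_subset _ _).trans hIS)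
    have hJ : s.FullK (insert v (I.erase i)) := by
      intro a ha b hb hab
      rw [mem_insert, mem_erase] at ha hb
      rcases ha with rfl | ha
      · rcases hb with rfl | hb
        · exact absurd rfl hab
        · exact hfull b hb.2 hb.1
      · rcases hb with rfl | hb
        · exact s.full_symm (hfull a ha.2 ha.1)
        · exact hI a ha.2 b hb.2 hab
    refine ⟨i, himem.1, himem.2, hfull, ?_, ?_⟩
    · intro a ha hai
      have d1 := o.k5deg hR hIS hI5 hI ha
      have d2 := o.k5deg hR hJS hJ5 hJ (a := a) (mem_insert_of_mem (mem_erase.2 ⟨hai, ha⟩))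
      rw [← insert_erase himem.1, filter_insert] at d1
      rw [filter_insert] at d2
      have n1 : i ∉ (I.erase i).filter (s.red a) := by simp
      have n2 : v ∉ (I.erase i).filter (s.red a) := fun h => hve (mem_of_mem_filter _ h)
      by_cases c1 : s.red a i <;> by_cases c2 : s.red a v
      · simp [c1, c2]
      · rw [if_pos c1, card_insert_of_notMem n1] at d1
        rw [if_neg c2] at d2
        omega
      · rw [if_neg c1] at d1
        rw [if_pos c2, card_insert_of_notMem n2] at d2
        omega
      · simp [c1, c2]
    · have m1 := hImax (insert v (I.erase i)) ⟨⟨hJS, hJ5⟩, hJ⟩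
      rw [sum_insert hve, ← add_sum_erase I x himem.1] at m1
      have m2 := o.hpair hvS (hIS himem.1) himem.2
      linarith
  have hAS : ∀ v ∈ A, v ∈ S ∧ v ∉ I := by
    intro v hv
    rw [hA, mem_filter, mem_sdiff] at hv
    exact hv.1
  have fbI := fun {u v : ι} (hu : u ∈ I) (hv : v ∈ I) huv hr => hI.fb (u := u) (v := v) hu hv huv hr
    (hR u (hIS hu)) (hR v (hIS hv))
  have hA2 : A.card ≤ 2 := by
    by_contra hc
    obtain ⟨u, hu, v, hv, z, hz, huv, huz, hvz⟩ := two_lt_card.1 (not_le.1 hc)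
    obtain ⟨iu, hiu⟩ := hclone u hu
    obtain ⟨iv, hiv⟩ := hclone v hv
    obtain ⟨iz, hiz⟩ := hclone z hz
    have key : ∀ u ∈ A, ∀ v ∈ A, u ≠ v → ∀ i ∈ I, ∀ j ∈ I, s.h u i → s.h v j →
        (∀ a ∈ I, a ≠ i → s.full u a) → (∀ a ∈ I, a ≠ j → s.full v a) →
        (∀ a ∈ I, a ≠ i → (s.red a u ↔ s.red a i)) →
        (∀ a ∈ I, a ≠ j → (s.red a v ↔ s.red a j)) → s.red i j := by
      intro u hu v hv huv i hi j hj hui hvj fu fv cu cv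
      have huS := hAS u hu
      have hvS := hAS v hv
      have fbx : ∀ {y a : ι}, y ∈ S → a ∈ S → s.full y a → ¬ s.red a y → s.fb y a := by
        intro y a hy ha hf hr
        rcases hf with h | h | h
        · exact absurd (s.red_symm _ _ h) hr
        · exact h
        · exact absurd h.2 (by simp [hR y hy, hR a ha])
      by_cases hij : i = j
      · exfalso
        subst hij
        have hdeg := o.k5deg hR hIS hI5 hI hi
        obtain ⟨a, ha⟩ := card_pos.1 (show 0 < (I.filter (s.red i)).card by omega)
        rw [mem_filter] at ha
        have hai : a ≠ i := by rintro rfl; exact s.red_irr _ ha.2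
        have hau := (cu a ha.1 hai).2 (s.red_symm _ _ ha.2)
        have hav := (cv a ha.1 hai).2 (s.red_symm _ _ ha.2)
        have hnr : ¬ s.red u v := fun h => s.red_tri a u v hau h hav
        have hbl := o.nz.red_or_bl huS.1 hvS.1 huv hnr
        have hbe : ∃ b ∈ I, b ≠ i ∧ ¬ s.red i b := by
          by_contra hno
          push Not at hno
          have : I.erase i ⊆ I.filter (s.red i) := by
            intro b hb
            rw [mem_erase] at hb
            exact mem_filter.2 ⟨hb.2, hno b hb.2 hb.1⟩
          have := card_le_card this
          rw [card_erase_of_mem hi] at this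
          omega
        obtain ⟨b, hb, hbi, hnb⟩ := hbe
        have hnb' : ¬ s.red b i := fun h => hnb (s.red_symm _ _ h)
        have f1 := fbx huS.1 (hIS hb) (fu b hb hbi) (fun h => hnb' ((cu b hb hbi).1 h))
        have f2 := fbx hvS.1 (hIS hb) (fv b hb hbi) (fun h => hnb' ((cv b hb hbi).1 h))
        have f3 := fbI hi hb hbi.symm hnb
        exact o.nf4 (hm _ huS.1) (hm _ (hIS hb)) (hm _ hvS.1) (hm _ (hIS hi)) f1 hvj.1 hbl hui.1
          (s.bl_symm _ _ (s.fb_bl _ _ f2)) (s.bl_symm _ _ (s.fb_bl _ _ f3))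
      · by_contra hnr
        have hnr' : ¬ s.red j i := fun h => hnr (s.red_symm _ _ h)
        have f0 := fbI hi hj hij hnr
        have f1 := fbx huS.1 (hIS hj) (fu j hj (Ne.symm hij)) (fun h => hnr' ((cu j hj (Ne.symm hij)).1 h))
        have f2 := fbx hvS.1 (hIS hi) (fv i hi hij) (fun h => hnr ((cv i hi hij).1 h))
        -- common red neighbour
        have hdi := o.k5deg hR hIS hI5 hI hi
        have hdj := o.k5deg hR hIS hI5 hI hj
        have hcom : ∃ c ∈ I, s.red i c ∧ s.red j c := by
          by_contra hno
          push Not at hno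
          have hdis : Disjoint (I.filter (s.red i)) (I.filter (s.red j)) := by
            rw [disjoint_left]
            intro c hc hc'
            rw [mem_filter] at hc hc'
            exact hno c hc.1 hc.2 hc'.2
          have hsub : I.filter (s.red i) ∪ I.filter (s.red j) ⊆ (I.erase i).erase j := by
            intro c hc
            rw [mem_union, mem_filter, mem_filter] at hc
            rw [mem_erase, mem_erase]
            rcases hc with hc | hc
            · exact ⟨by rintro rfl; exact hnr hc.2, by rintro rfl; exact s.red_irr _ hc.2, hc.1⟩
            · exact ⟨by rintro rfl; exact s.red_irr _ hc.2, by rintro rfl; exact hnr' hc.2, hc.1⟩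
          have := card_le_card hsub
          rw [card_union_of_disjoint hdis, card_erase_of_mem (mem_erase.2 ⟨Ne.symm hij, hj⟩),
            card_erase_of_mem hi] at this
          omega
        obtain ⟨c, hc, hic, hjc⟩ := hcom
        have hci : c ≠ i := by rintro rfl; exact s.red_irr _ hic
        have hcj : c ≠ j := by rintro rfl; exact s.red_irr _ hjc
        have r1 := (cu c hc hci).2 (s.red_symm _ _ hic)
        have r2 := (cv c hc hcj).2 (s.red_symm _ _ hjc)
        have hbl := o.nz.red_or_bl huS.1 hvS.1 huv (fun h => s.red_tri c u v r1 h r2)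
        exact o.nf4 (hm _ (hIS hi)) (hm _ (hIS hj)) (hm _ huS.1) (hm _ hvS.1) f0 hbl
          (s.bl_symm _ _ hui.1) (s.bl_symm _ _ (s.fb_bl _ _ f2))
          (s.bl_symm _ _ (s.fb_bl _ _ f1)) (s.bl_symm _ _ hvj.1)
    exact s.red_tri iu iv iz
      (key u hu v hv huv iu hiu.1 iv hiv.1 hiu.2.1 hiv.2.1 hiu.2.2.1 hiv.2.2.1 hiu.2.2.2.1 hiv.2.2.2.1)
      (key v hv z hz hvz iv hiv.1 iz hiz.1 hiv.2.1 hiz.2.1 hiv.2.2.1 hiz.2.2.1 hiv.2.2.2.1 hiz.2.2.2.1)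
      (key u hu z hz huz iu hiu.1 iz hiz.1 hiu.2.1 hiz.2.1 hiu.2.2.1 hiz.2.2.1 hiu.2.2.2.1 hiz.2.2.2.1)
  have hAx : ∑ v ∈ A, x v ≤ 4 / 3 * t := by
    have := sum_le_card_nsmul A x (2 / 3 * t) (fun v hv => by
      obtain ⟨i, hi⟩ := hclone v hv
      exact hi.2.2.2.2)
    rw [nsmul_eq_mul] at this
    have h2 : (A.card : ℝ) ≤ 2 := by exact_mod_cast hA2
    nlinarith
  -- sum the equations over I
  have heq : ∑ i ∈ I, (x i + 1 / 2 * ∑ u ∈ S.filter (s.h i), x u) = 5 * t := by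
    rw [sum_congr rfl fun i hi => o.eq i (hIS hi), sum_const, hI5, nsmul_eq_mul]; norm_num
  have hswap : ∑ i ∈ I, ∑ u ∈ S.filter (s.h i), x u = ∑ u ∈ S, k u * x u := by
    simp_rw [sum_filter]
    rw [sum_comm]
    refine sum_congr rfl fun u _ => ?_
    rw [hk, ← sum_filter, sum_const, nsmul_eq_mul]
    congr 3
    ext i
    simp only [mem_filter]
    exact and_congr_right fun _ => ⟨s.h_symm, s.h_symm⟩
  rw [sum_add_distrib, ← mul_sum, hswap] at heq
  have hlow : ∑ u ∈ S \ I, (2 * x u - if k u = 1 then x u else 0) ≤ ∑ u ∈ S, k u * x u := by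
    refine le_trans (sum_le_sum (g := fun u => (k u : ℝ) * x u) ?_) (sum_le_sum_of_subset_of_nonneg sdiff_subset ?_)
    · intro u hu
      have h1 := hk1 u hu
      have hp := o.pos u (mem_sdiff.1 hu).1
      split_ifs with h
      · rw [h]; norm_num; linarith
      · have : 2 ≤ k u := by omega
        have : (2 : ℝ) ≤ k u := by exact_mod_cast this
        nlinarith
    · intro u hu _
      exact mul_nonneg (Nat.cast_nonneg _) (o.pos u hu).le
  rw [sum_sub_distrib, ← mul_sum, ← sum_filter] at hlow
  have htot := sum_sdiff (f := x) hIS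
  rw [o.sum] at htot
  have : ∑ v ∈ A, x v = ∑ a ∈ S \ I with k a = 1, x a := rfl
  linarith

end zero

open Classical in
lemma Opt.main (o : s.Opt x S t) (hx : ∀ i, i ∉ S → x i = 0) :
    ∃ C ⊆ S, C.card = 6 ∧ s.FullK C := by
  rcases (show (S.filter s.R).card = 0 ∨ (S.filter s.R).card = 1 ∨ (S.filter s.R).card = 2 ∨
    3 ≤ (S.filter s.R).card by omega) with h | h | h | h
  · rw [card_eq_zero, filter_eq_empty_iff] at h
    exact o.case_0 hx h
  · exact ⟨S, subset_rfl, o.small (o.case_1 h)⟩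
  · exact ⟨S, subset_rfl, o.small (o.case_2 h)⟩
  · exact ⟨S, subset_rfl, o.small (o.case_ge3 h)⟩

end Sys
end RT36

end

section

open Finset

namespace RT36
namespace Sys
set_option linter.unusedSectionVars false
variable {ι : Type*} [Fintype ι] {s : Sys ι}

lemma opt_of (x : ι → ℝ) (hx0 : ∀ i, 0 ≤ x i) (hx1 : ∑ i, x i = 1)
    (hlin : ∀ v, 0 < x v → lin s.w x v = quad s.w x)
    (hne : ∀ u v, u ≠ v → 0 < x u → 0 < x v → s.w u v ≠ 0) (ht : 83 / 100 < quad s.w x) :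
    s.Opt x (univ.filter fun i => 0 < x i) (1 - quad s.w x) := by
  classical
  have hoff : ∀ i, i ∉ (univ.filter fun i => 0 < x i) → x i = 0 := by
    intro i hi
    by_contra h
    exact hi (mem_filter.2 ⟨mem_univ _, lt_of_le_of_ne (hx0 i) (Ne.symm h)⟩)
  have hS1 : ∑ i ∈ (univ.filter fun i => 0 < x i), x i = 1 := by
    rw [← hx1]; exact sum_subset (subset_univ _) fun i _ hi => hoff i hi
  refine ⟨fun v hv => (mem_filter.1 hv).2, hS1, ?_, ?_, by linarith⟩
  · intro u hu v hv huv
    exact s.w_ne (hne u v huv (mem_filter.1 hu).2 (mem_filter.1 hv).2)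
  · intro v hv
    have h1 := hlin v (mem_filter.1 hv).2
    rw [← h1]
    unfold lin
    have h2 : ∑ j, s.w v j * x j = ∑ j ∈ (univ.filter fun i => 0 < x i), s.w v j * x j :=
      (sum_subset (subset_univ _) fun i _ hi => by rw [hoff i hi, mul_zero]).symm
    rw [h2, ← hS1, sum_filter (p := s.h v), mul_sum, ← sum_sub_distrib]
    have h3 : x v = ∑ j ∈ (univ.filter fun i => 0 < x i), if v = j then x j else 0 := by
      rw [sum_ite_eq, if_pos hv]
    rw [h3, ← sum_add_distrib]
    refine sum_congr rfl fun j hj => ?_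
    by_cases hvj : v = j
    · subst hvj
      have : ¬ s.h v v := fun h => s.bl_irr _ h.1
      simp [this, s.w_diag]
    · have := hne v j hvj (mem_filter.1 hv).2 (mem_filter.1 hj).2
      rcases s.w_cases v j with h | h | h
      · have h' : ¬ s.h v j := fun h' => h'.2 h.1
        simp [hvj, h.2, h']
      · rw [hS1, h.2]; simp [hvj, h.1]; ring
      · exact absurd h this

lemma exists_K6 (q : ι → ℝ) (hq0 : ∀ i, 0 ≤ q i) (hq1 : ∑ i, q i = 1)
    (h : 83 / 100 < quad s.w q) :
    ∃ C : Finset ι, (∀ c ∈ C, q c ≠ 0) ∧ C.card = 6 ∧ s.FullK C ∧ quad s.w q ≤ 5 / 6 := by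
  classical
  obtain ⟨x, hx0, hx1, hqx, hle, hlin, hne⟩ := lagrange s.w s.w_symm s.w_diag q hq0 hq1
  have o := opt_of x hx0 hx1 hlin hne (by linarith)
  obtain ⟨C, hCS, hC6, hC⟩ := o.main (by
    intro i hi
    by_contra h
    exact hi (mem_filter.2 ⟨mem_univ _, lt_of_le_of_ne (hx0 i) (Ne.symm h)⟩))
  refine ⟨C, fun c hc h0 => ?_, hC6, hC, hle.trans ?_⟩
  · have := (mem_filter.1 (hCS hc)).2
    rw [hqx c h0] at this
    exact lt_irrefl _ this
  · have h1 : ∑ c ∈ C, lin s.w x c = 6 * quad s.w x := by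
      rw [sum_congr rfl fun c hc => hlin c (mem_filter.1 (hCS hc)).2, sum_const, hC6]
      simp
    have h2 : ∑ c ∈ C, lin s.w x c ≤ 5 := by
      unfold lin
      rw [sum_comm]
      calc ∑ v, ∑ c ∈ C, s.w c v * x v ≤ ∑ v, 5 * x v := by
            refine sum_le_sum fun v _ => ?_
            rw [← sum_mul]
            refine mul_le_mul_of_nonneg_right ?_ (hx0 v)
            obtain ⟨c, hc, hvc⟩ : ∃ c ∈ C, s.w v c = 0 := by
              by_contra hcon
              push Not at hcon
              exact claimZ hC6 hC v hcon
            rw [← add_sum_erase C _ hc, s.w_symm c v, hvc, zero_add]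
            calc _ ≤ ∑ c ∈ C.erase c, (1 : ℝ) := sum_le_sum fun i _ => s.w_le_one _ _
              _ = 5 := by rw [sum_const, card_erase_of_mem hc, hC6]; simp
        _ = 5 := by rw [← mul_sum, hx1, mul_one]
    linarith

lemma quad_smul (w : ι → ι → ℝ) (c : ℝ) (q : ι → ℝ) :
    quad w (fun i => c * q i) = c ^ 2 * quad w q := by
  unfold quad
  rw [mul_sum]
  refine sum_congr rfl fun i _ => ?_
  rw [mul_sum]
  exact sum_congr rfl fun j _ => by ring

lemma quad_nonneg (q : ι → ℝ) (hq0 : ∀ i, 0 ≤ q i) : 0 ≤ quad s.w q :=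
  sum_nonneg fun i _ => sum_nonneg fun j _ =>
    mul_nonneg (mul_nonneg (s.w_nonneg _ _) (hq0 _)) (hq0 _)

lemma quad_le (q : ι → ℝ) (hq0 : ∀ i, 0 ≤ q i) : quad s.w q ≤ 5 / 6 * (∑ i, q i) ^ 2 := by
  rcases (sum_nonneg fun i (_ : i ∈ univ) => hq0 i).eq_or_lt with h0 | h0
  · have : ∀ i, q i = 0 := fun i => (sum_eq_zero_iff_of_nonneg fun i _ => hq0 i).1 h0.symm i (mem_univ _)
    unfold quad
    simp [this]
  · set m := ∑ i, q i with hm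
    have h1 : ∑ i, m⁻¹ * q i = 1 := by rw [← mul_sum, ← hm, inv_mul_cancel₀ h0.ne']
    have h2 : quad s.w (fun i => m⁻¹ * q i) ≤ 5 / 6 := by
      rcases le_or_gt (quad s.w (fun i => m⁻¹ * q i)) (83 / 100) with h | h
      · linarith
      · obtain ⟨_, _, _, _, h⟩ := exists_K6 _ (fun i => mul_nonneg (inv_nonneg.2 h0.le) (hq0 i)) h1 h
        exact h
    rw [quad_smul, inv_pow, inv_mul_le_iff₀ (by positivity)] at h2
    linarith

theorem stable (s : Sys ι) (p : ι → ℝ) (hp0 : ∀ i, 0 ≤ p i) (hp1 : ∑ i, p i = 1) (θ : ℝ) (hθ : 0 < θ)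
    (hθ' : θ ≤ 1 / 1000) (hq : 5 / 6 - θ ^ 2 ≤ quad s.w p) :
    ∃ (κ : ι → Fin 6) (E : Finset ι), ∑ i ∈ E, p i ≤ 12 * θ ∧
      ∀ u, u ∉ E → ∀ v, v ∉ E → κ u = κ v → ¬ s.red u v ∧ ¬ s.bl u v := by
  classical
  set L := univ.filter fun i => lin s.w p i < 5 / 6 - θ with hL
  set ℓ := ∑ i ∈ L, p i with hℓ
  have hℓ0 : 0 ≤ ℓ := sum_nonneg fun i _ => hp0 i
  set pL : ι → ℝ := fun i => if i ∈ L then p i else 0 with hpL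
  have hpL0 : ∀ i, 0 ≤ pL i := fun i => by
    simp only [hpL]; split_ifs
    · exact hp0 i
    · exact le_rfl
  have hpLs : ∑ i, pL i = ℓ := by simp [hpL, hℓ, sum_ite_mem]
  have key : ∀ c : ℝ, quad s.w (p + fun i => (-c) * pL i)
      = quad s.w p - 2 * c * (∑ i ∈ L, p i * lin s.w p i) + c ^ 2 * quad s.w pL := by
    intro c
    rw [quad_add _ s.w_symm, quad_smul]
    have : ∑ i, -c * pL i * lin s.w p i = -c * ∑ i ∈ L, p i * lin s.w p i := by
      rw [mul_sum, ← sum_subset (subset_univ L)]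
      · refine sum_congr rfl fun i hi => ?_
        simp only [hpL, if_pos hi]; ring
      · intro i _ hi
        simp [hpL, if_neg hi]
    rw [this]; ring
  have hlL : ∑ i ∈ L, p i * lin s.w p i ≤ (5 / 6 - θ) * ℓ := by
    rw [hℓ, mul_sum]
    refine sum_le_sum fun i hi => ?_
    rw [mul_comm]
    exact mul_le_mul_of_nonneg_right (mem_filter.1 hi).2.le (hp0 i)
  have hℓθ : ℓ ≤ θ := by
    by_contra hcon
    push Not at hcon
    have hℓp : 0 < ℓ := hθ.trans hcon
    set c := θ / ℓ with hc
    have hc0 : 0 < c := div_pos hθ hℓp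
    have hc1 : c ≤ 1 := (div_le_one hℓp).2 hcon.le
    have hcl : c * ℓ = θ := div_mul_cancel₀ _ hℓp.ne'
    have h1 := quad_le (s := s) (p + fun i => (-c) * pL i) (by
      intro i
      simp only [Pi.add_apply, hpL]
      split_ifs
      · nlinarith [hp0 i]
      · simpa using hp0 i)
    rw [key c] at h1
    have h2 : ∑ i, (p + fun i => (-c) * pL i) i = 1 - θ := by
      simp only [Pi.add_apply, sum_add_distrib, hp1, ← mul_sum, hpLs]
      linarith
    rw [h2] at h1
    have h3 : 0 ≤ c ^ 2 * quad s.w pL := mul_nonneg (sq_nonneg _) (quad_nonneg _ hpL0)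
    have h4 : c * (∑ i ∈ L, p i * lin s.w p i) ≤ (5 / 6 - θ) * θ := by
      calc _ ≤ c * ((5 / 6 - θ) * ℓ) := mul_le_mul_of_nonneg_left hlL hc0.le
        _ = (5 / 6 - θ) * (c * ℓ) := by ring
        _ = _ := by rw [hcl]
    nlinarith
  have hqq0 : ∀ i, 0 ≤ (p + fun i => (-1) * pL i) i := by
    intro i
    simp only [Pi.add_apply, hpL]
    split_ifs
    · simp
    · simpa using hp0 i
  have hqs : ∑ i, (p + fun i => (-1) * pL i) i = 1 - ℓ := by
    simp only [Pi.add_apply, sum_add_distrib, hp1, ← mul_sum, hpLs]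
    linarith
  have h5 : 83 / 100 < quad s.w (p + fun i => (-1) * pL i) := by
    rw [key 1]
    have h3 : 0 ≤ 1 ^ 2 * quad s.w pL := mul_nonneg (sq_nonneg _) (quad_nonneg _ hpL0)
    have h4 : (5 / 6 - θ) * ℓ ≤ θ := by nlinarith
    nlinarith
  set m := 1 - ℓ with hm
  have hm0 : 0 < m := by linarith
  obtain ⟨C, hCne, hC6, hC, -⟩ := exists_K6 (s := s) (fun i => m⁻¹ * (p + fun i => (-1) * pL i) i)
    (fun i => mul_nonneg (inv_nonneg.2 hm0.le) (hqq0 i))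
    (by rw [← mul_sum, hqs, inv_mul_cancel₀ hm0.ne'])
    (by
      rw [quad_smul, inv_pow]
      refine h5.trans_le ?_
      rw [← div_eq_inv_mul, le_div_iff₀ (by positivity)]
      have : m ^ 2 ≤ 1 := by nlinarith
      nlinarith)
  have hCL : ∀ c ∈ C, 5 / 6 - θ ≤ lin s.w p c := by
    intro c hc
    by_contra h
    push Not at h
    have hcL : c ∈ L := mem_filter.2 ⟨mem_univ _, h⟩
    apply hCne c hc
    simp [hpL, hcL]
  have hz : ∀ v, ∃ c ∈ C, s.w v c = 0 := by
    intro v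
    by_contra hcon
    push Not at hcon
    exact claimZ hC6 hC v hcon
  choose z hzC hz0 using hz
  set E := univ.filter fun v => ∃ d ∈ C, d ≠ z v ∧ s.w v d ≠ 1 with hE
  refine ⟨fun v => (Finset.equivFinOfCardEq hC6) ⟨z v, hzC v⟩, E, ?_, ?_⟩
  · have h1 : 5 - 6 * θ ≤ ∑ c ∈ C, lin s.w p c := by
      calc 5 - 6 * θ = ∑ c ∈ C, (5 / 6 - θ) := by rw [sum_const, hC6]; simp; ring
        _ ≤ _ := sum_le_sum hCL
    have h2 : ∑ c ∈ C, lin s.w p c ≤ ∑ v, (5 * p v - 1 / 2 * (if v ∈ E then p v else 0)) := by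
      unfold lin
      rw [sum_comm]
      refine sum_le_sum fun v _ => ?_
      rw [← sum_mul, ← add_sum_erase C _ (hzC v), s.w_symm (z v) v, hz0, zero_add]
      split_ifs with hv
      · obtain ⟨-, d, hd, hdz, hd1⟩ := mem_filter.1 hv
        have hd' : d ∈ C.erase (z v) := mem_erase.2 ⟨hdz, hd⟩
        rw [← add_sum_erase _ _ hd']
        have h3 : s.w d v ≤ 1 / 2 := by
          rw [s.w_symm]
          rcases s.w_cases v d with h | h | h
          · exact absurd h.2 hd1
          · rw [h.2]
          · rw [h]; norm_num
        have h4 : ∑ c ∈ (C.erase (z v)).erase d, s.w c v ≤ 4 := by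
          calc _ ≤ ∑ c ∈ (C.erase (z v)).erase d, (1 : ℝ) := sum_le_sum fun i _ => s.w_le_one _ _
            _ = 4 := by rw [sum_const, card_erase_of_mem hd', card_erase_of_mem (hzC v), hC6]; simp
        nlinarith [hp0 v]
      · have h4 : ∑ c ∈ C.erase (z v), s.w c v ≤ 5 := by
          calc _ ≤ ∑ c ∈ C.erase (z v), (1 : ℝ) := sum_le_sum fun i _ => s.w_le_one _ _
            _ = 5 := by rw [sum_const, card_erase_of_mem (hzC v), hC6]; simp
        nlinarith [hp0 v]
    rw [sum_sub_distrib, ← mul_sum, ← mul_sum, hp1, sum_ite_mem, univ_inter] at h2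
    linarith
  · intro u hu v hv huv
    have hzz : z u = z v := by
      have := (Finset.equivFinOfCardEq hC6).injective huv
      exact congrArg Subtype.val this
    have hu1 : ∀ d ∈ C, d ≠ z u → s.w u d = 1 := by
      intro d hd hdz
      by_contra h
      exact hu (mem_filter.2 ⟨mem_univ _, d, hd, hdz, h⟩)
    have hv1 : ∀ d ∈ C, d ≠ z v → s.w v d = 1 := by
      intro d hd hdz
      by_contra h
      exact hv (mem_filter.2 ⟨mem_univ _, d, hd, hdz, h⟩)
    have hfull : ∀ d ∈ C, d ≠ z u → s.full u d := by
      intro d hd hdz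
      have := hu1 d hd hdz
      rcases s.w_cases u d with h | h | h
      · exact h.1
      · rw [h.2] at this; norm_num at this
      · rw [h] at this; norm_num at this
    have huC : u ∉ C.erase (z u) := by
      intro h
      rw [mem_erase] at h
      have := hu1 u h.2 h.1
      rw [s.w_diag] at this; norm_num at this
    apply s.w_zero
    by_contra hne
    refine claimZ (s := s) (C := insert u (C.erase (z u))) ?_ ?_ v ?_
    · rw [card_insert_of_notMem huC, card_erase_of_mem (hzC u), hC6]
    · intro a ha b hb hab
      rw [mem_insert, mem_erase] at ha hb
      rcases ha with rfl | ha <;> rcases hb with rfl | hb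
      · exact absurd rfl hab
      · exact hfull b hb.2 hb.1
      · exact s.full_symm (hfull a ha.2 ha.1)
      · exact hC a ha.2 b hb.2 hab
    · intro d hd
      rw [mem_insert, mem_erase] at hd
      rcases hd with rfl | hd
      · rwa [s.w_symm]
      · rw [hv1 d hd.2 (hzz ▸ hd.1)]; norm_num

end Sys
end RT36

end

section

open Finset

namespace RT36
set_option linter.unusedSectionVars false

/-! ### Conditional expectation on a finite set -/
section cond
variable {W κ : Type*} [Fintype W] [DecidableEq κ]

noncomputable def cav (G : W → κ) (F : W → ℝ) (w : W) : ℝ :=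
  (∑ z ∈ univ.filter (fun z => G z = G w), F z) / ((univ.filter (fun z => G z = G w)).card : ℝ)

lemma cav_proj [Fintype κ] (G : W → κ) (F : W → ℝ) (H : κ → ℝ) :
    ∑ w, cav G F w * H (G w) = ∑ w, F w * H (G w) := by
  rw [← sum_fiberwise univ G (fun w => cav G F w * H (G w)),
    ← sum_fiberwise univ G (fun w => F w * H (G w))]
  refine sum_congr rfl fun c _ => ?_
  have h1 : ∑ w ∈ univ.filter (fun z => G z = c), cav G F w * H (G w)
      = ∑ w ∈ univ.filter (fun z => G z = c), ((∑ z ∈ univ.filter (fun z => G z = c), F z) /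
        ((univ.filter (fun z => G z = c)).card : ℝ)) * H c := by
    refine sum_congr rfl fun w hw => ?_
    have := (mem_filter.1 hw).2
    unfold cav
    rw [this]
  have h2 : ∑ w ∈ univ.filter (fun z => G z = c), F w * H (G w)
      = (∑ w ∈ univ.filter (fun z => G z = c), F w) * H c := by
    rw [sum_mul]
    refine sum_congr rfl fun w hw => ?_
    rw [(mem_filter.1 hw).2]
  rw [h1, h2, sum_const, nsmul_eq_mul]
  rcases (univ.filter (fun z => G z = c)).eq_empty_or_nonempty with h | h
  · rw [h]; simp
  · have : ((univ.filter (fun z => G z = c)).card : ℝ) ≠ 0 := by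
      exact_mod_cast (card_pos.2 h).ne'
    field_simp

lemma cav_meas (G : W → κ) (F : W → ℝ) : ∃ H : κ → ℝ, ∀ w, cav G F w = H (G w) :=
  ⟨fun c => (∑ z ∈ univ.filter (fun z => G z = c), F z) /
    ((univ.filter (fun z => G z = c)).card : ℝ), fun _ => rfl⟩

lemma cav_sq [Fintype κ] (G : W → κ) (F : W → ℝ) :
    ∑ w, cav G F w ^ 2 = ∑ w, F w * cav G F w := by
  obtain ⟨H, hH⟩ := cav_meas G F
  have := cav_proj G F H
  simp_rw [← hH] at this
  rw [← this]
  exact sum_congr rfl fun w _ => by ring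

lemma cav_energy_le [Fintype κ] (G : W → κ) (F : W → ℝ) (h0 : ∀ w, 0 ≤ F w) (h1 : ∀ w, F w ≤ 1) :
    ∑ w, cav G F w ^ 2 ≤ Fintype.card W := by
  have h := cav_sq G F
  have h2 : ∑ w, F w * cav G F w ≤ ∑ w, (F w ^ 2 + cav G F w ^ 2) / 2 :=
    sum_le_sum fun w _ => by nlinarith [sq_nonneg (F w - cav G F w)]
  rw [← sum_div, sum_add_distrib] at h2
  have h3 : ∑ w, F w ^ 2 ≤ ∑ w : W, (1 : ℝ) := sum_le_sum fun w _ => by nlinarith [h0 w, h1 w]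
  simp at h3
  linarith

lemma cav_pyth {κ' : Type*} [Fintype κ] [Fintype κ'] [DecidableEq κ'] (G : W → κ) (G' : W → κ')
    (π : κ' → κ) (hπ : ∀ w, G w = π (G' w)) (F : W → ℝ) :
    ∑ w, (cav G' F w - cav G F w) ^ 2 = ∑ w, cav G' F w ^ 2 - ∑ w, cav G F w ^ 2 := by
  obtain ⟨H, hH⟩ := cav_meas G F
  have h1 := cav_proj G' F (fun c => H (π c))
  have h2 := cav_sq G F
  simp_rw [← hπ, ← hH] at h1
  have : ∀ w, (cav G' F w - cav G F w) ^ 2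
      = cav G' F w ^ 2 - 2 * (cav G' F w * cav G F w) + cav G F w ^ 2 := fun w => by ring
  simp_rw [this]
  rw [sum_add_distrib, sum_sub_distrib, ← mul_sum, h1, h2]
  ring

end cond

section reg
variable {V : Type*} [Fintype V] [DecidableEq V]

noncomputable def eW (F : V × V → ℝ) (X Y : Finset V) : ℝ := ∑ z ∈ X ×ˢ Y, F z

noncomputable def dW (F : V × V → ℝ) (X Y : Finset V) : ℝ := eW F X Y / (X.card * Y.card)

def RegW (F : V × V → ℝ) (ε : ℝ) (X Y : Finset V) : Prop :=
  ∀ X' ⊆ X, ∀ Y' ⊆ Y, ε * X.card ≤ X'.card → ε * Y.card ≤ Y'.card →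
    |eW F X' Y' - dW F X Y * (X'.card * Y'.card)| ≤ ε * (X'.card * Y'.card)

def cls {κ : Type*} [DecidableEq κ] (f : V → κ) (i : κ) : Finset V := univ.filter fun v => f v = i

lemma mem_cls {κ : Type*} [DecidableEq κ] {f : V → κ} {i : κ} {v : V} : v ∈ cls f i ↔ f v = i := by
  simp [cls]

lemma cav_eq_dW {κ : Type*} [DecidableEq κ] (f : V → κ) (F : V × V → ℝ) (z : V × V) :
    cav (fun z : V × V => (f z.1, f z.2)) F z = dW F (cls f (f z.1)) (cls f (f z.2)) := by
  unfold cav dW eW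
  have : (univ.filter fun y : V × V => (f y.1, f y.2) = (f z.1, f z.2))
      = cls f (f z.1) ×ˢ cls f (f z.2) := by
    ext ⟨a, b⟩
    simp [cls]
  rw [this, card_product]
  push_cast
  rfl

open Classical in
noncomputable def irr {k : ℕ} (F : Bool → V × V → ℝ) (ε : ℝ) (f : V → Fin k) : Finset (Fin k × Fin k) :=
  univ.filter fun p => ∃ b, ¬ RegW (F b) ε (cls f p.1) (cls f p.2)

noncomputable def energy {κ : Type*} [DecidableEq κ] (F : Bool → V × V → ℝ) (f : V → κ) : ℝ :=
  ∑ b, ∑ z, cav (fun z : V × V => (f z.1, f z.2)) (F b) z ^ 2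

lemma energy_le {k : ℕ} (F : Bool → V × V → ℝ) (h0 : ∀ b w, 0 ≤ F b w) (h1 : ∀ b w, F b w ≤ 1)
    (f : V → Fin k) : energy F f ≤ 2 * (Fintype.card V : ℝ) ^ 2 := by
  unfold energy
  have : ∀ b, ∑ z, cav (fun z : V × V => (f z.1, f z.2)) (F b) z ^ 2 ≤ (Fintype.card V : ℝ) ^ 2 := by
    intro b
    have := cav_energy_le (fun z : V × V => (f z.1, f z.2)) (F b) (h0 b) (h1 b)
    rw [Fintype.card_prod] at this
    push_cast at this
    nlinarith
  calc _ ≤ ∑ b : Bool, (Fintype.card V : ℝ) ^ 2 := sum_le_sum fun b _ => this b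
    _ = _ := by simp

abbrev Nx (k : ℕ) : Type := Fin k × (Fin k × Fin k → Bool × Bool)

lemma reg_step {k : ℕ} (F : Bool → V × V → ℝ) (ε : ℝ) (hε : 0 < ε) (f : V → Fin k)
    (hbad : ε * (Fintype.card V : ℝ) ^ 2
      < ∑ p ∈ irr F ε f, ((cls f p.1).card : ℝ) * (cls f p.2).card) :
    ∃ g : V → Nx k, (∀ v, f v = (g v).1) ∧
      energy F f + ε ^ 5 * (Fintype.card V : ℝ) ^ 2 ≤ energy F g := by
  classical
  have hw : ∀ p : Fin k × Fin k, ∃ (b : Bool) (X' Y' : Finset V), p ∈ irr F ε f →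
      X' ⊆ cls f p.1 ∧ Y' ⊆ cls f p.2 ∧ ε * (cls f p.1).card ≤ X'.card ∧
      ε * (cls f p.2).card ≤ Y'.card ∧
      ε * (X'.card * Y'.card) < |eW (F b) X' Y' - dW (F b) (cls f p.1) (cls f p.2) * (X'.card * Y'.card)| := by
    intro p
    by_cases hp : p ∈ irr F ε f
    · obtain ⟨-, b, hb⟩ := mem_filter.1 hp
      unfold RegW at hb
      push Not at hb
      obtain ⟨X', h1, Y', h2, h3, h4, h5⟩ := hb
      exact ⟨b, X', Y', fun _ => ⟨h1, h2, h3, h4, h5⟩⟩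
    · exact ⟨true, ∅, ∅, fun h => absurd h hp⟩
  choose b X' Y' hw using hw
  set g : V → Nx k := fun v => (f v, fun p => (decide (v ∈ X' p), decide (v ∈ Y' p))) with hg
  refine ⟨g, fun v => rfl, ?_⟩
  have hpy : energy F g - energy F f = ∑ c, ∑ z, (cav (fun z : V × V => (g z.1, g z.2)) (F c) z
      - cav (fun z : V × V => (f z.1, f z.2)) (F c) z) ^ 2 := by
    unfold energy
    rw [← sum_sub_distrib]
    refine sum_congr rfl fun c _ => ?_
    rw [cav_pyth (fun z : V × V => (f z.1, f z.2)) (fun z : V × V => (g z.1, g z.2))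
      (fun c => (c.1.1, c.2.1)) (fun z => rfl)]
  set D : Bool → V × V → ℝ := fun c z => cav (fun z : V × V => (g z.1, g z.2)) (F c) z
      - cav (fun z : V × V => (f z.1, f z.2)) (F c) z with hD
  have hinc : ∀ p ∈ irr F ε f, ε ^ 4 * (((cls f p.1).card : ℝ) * (cls f p.2).card)
      ≤ ∑ z ∈ X' p ×ˢ Y' p, D (b p) z ^ 2 := by
    intro p hp
    obtain ⟨h1, h2, h3, h4, h5⟩ := hw p hp
    set T := X' p ×ˢ Y' p with hT
    have hTc : (T.card : ℝ) = (X' p).card * (Y' p).card := by rw [hT, card_product]; push_cast; rfl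
    have hs : ∑ z ∈ T, D (b p) z = eW (F (b p)) (X' p) (Y' p)
        - dW (F (b p)) (cls f p.1) (cls f p.2) * ((X' p).card * (Y' p).card) := by
      rw [hD]
      simp only
      rw [sum_sub_distrib]
      congr 1
      · have := cav_proj (fun z : V × V => (g z.1, g z.2)) (F (b p))
          (fun c => if ((c.1.2 p).1 && (c.2.2 p).2) = true then (1 : ℝ) else 0)
        simp only [mul_ite, mul_one, mul_zero] at this
        rw [← sum_filter, ← sum_filter] at this
        have hTf : (univ.filter fun z : V × V => (((g z.1).2 p).1 && ((g z.2).2 p).2) = true) = T := by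
          ext ⟨u, v⟩
          simp [hg, hT]
        rw [hTf] at this
        exact this
      · rw [← hTc, mul_comm, ← nsmul_eq_mul, ← sum_const]
        refine sum_congr rfl fun z hz => ?_
        rw [cav_eq_dW]
        rw [hT, mem_product] at hz
        rw [mem_cls.1 (h1 hz.1), mem_cls.1 (h2 hz.2)]
    rw [← hs, ← hTc] at h5
    have cs := sq_sum_le_card_mul_sum_sq (s := T) (f := D (b p))
    have hT0 : (0 : ℝ) < T.card := by
      rcases T.eq_empty_or_nonempty with h | h
      · rw [h] at h5; simp at h5
      · exact_mod_cast card_pos.2 h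
    have h6 : (ε * T.card) ^ 2 ≤ (∑ z ∈ T, D (b p) z) ^ 2 := by
      rw [← sq_abs (∑ z ∈ T, D (b p) z)]
      exact pow_le_pow_left₀ (by positivity) h5.le 2
    have h7 : ε ^ 2 * T.card ≤ ∑ z ∈ T, D (b p) z ^ 2 := by
      have : (T.card : ℝ) * (ε ^ 2 * T.card) ≤ T.card * ∑ z ∈ T, D (b p) z ^ 2 := by nlinarith
      exact le_of_mul_le_mul_left this hT0
    have h8 : ε ^ 2 * (((cls f p.1).card : ℝ) * (cls f p.2).card) ≤ T.card := by
      rw [hTc]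
      calc _ = (ε * (cls f p.1).card) * (ε * (cls f p.2).card) := by ring
        _ ≤ _ := mul_le_mul h3 h4 (by positivity) (by positivity)
    calc _ = ε ^ 2 * (ε ^ 2 * (((cls f p.1).card : ℝ) * (cls f p.2).card)) := by ring
      _ ≤ ε ^ 2 * T.card := mul_le_mul_of_nonneg_left h8 (by positivity)
      _ ≤ _ := h7
  have hlow : ∑ p ∈ irr F ε f, ε ^ 4 * (((cls f p.1).card : ℝ) * (cls f p.2).card)
      ≤ ∑ c, ∑ z, D c z ^ 2 := by
    rw [sum_comm]
    calc _ ≤ ∑ p ∈ irr F ε f, ∑ z ∈ X' p ×ˢ Y' p, D (b p) z ^ 2 := sum_le_sum hinc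
      _ ≤ ∑ p ∈ irr F ε f, ∑ z ∈ univ.filter (fun z : V × V => (f z.1, f z.2) = p), ∑ c, D c z ^ 2 := by
        refine sum_le_sum fun p hp => ?_
        obtain ⟨h1, h2, -⟩ := hw p hp
        calc _ ≤ ∑ z ∈ X' p ×ˢ Y' p, ∑ c, D c z ^ 2 := by
              refine sum_le_sum fun z _ => ?_
              exact single_le_sum (f := fun c => D c z ^ 2) (fun c _ => sq_nonneg _) (mem_univ _)
          _ ≤ _ := by
            refine sum_le_sum_of_subset_of_nonneg ?_ fun z _ _ => sum_nonneg fun c _ => sq_nonneg _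
            intro z hz
            rw [mem_product] at hz
            have e1 := mem_cls.1 (h1 hz.1)
            have e2 := mem_cls.1 (h2 hz.2)
            exact mem_filter.2 ⟨mem_univ _, by rw [e1, e2]⟩
      _ ≤ ∑ p, ∑ z ∈ univ.filter (fun z : V × V => (f z.1, f z.2) = p), ∑ c, D c z ^ 2 :=
        sum_le_sum_of_subset_of_nonneg (subset_univ _)
          fun p _ _ => sum_nonneg fun z _ => sum_nonneg fun c _ => sq_nonneg _
      _ = _ := sum_fiberwise univ _ _
  rw [← mul_sum] at hlow
  have : ε ^ 4 * (ε * (Fintype.card V : ℝ) ^ 2) ≤ energy F g - energy F f := by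
    rw [hpy]
    exact (mul_le_mul_of_nonneg_left hbad.le (by positivity)).trans hlow
  nlinarith

lemma energy_equiv {κ κ' : Type*} [DecidableEq κ] [DecidableEq κ'] (F : Bool → V × V → ℝ) (f : V → κ)
    (e : κ ≃ κ') : energy F (fun v => e (f v)) = energy F f := by
  unfold energy
  refine sum_congr rfl fun b _ => sum_congr rfl fun z _ => ?_
  congr 1
  unfold cav
  have : (univ.filter fun y : V × V => (e (f y.1), e (f y.2)) = (e (f z.1), e (f z.2)))
      = univ.filter fun y : V × V => (f y.1, f y.2) = (f z.1, f z.2) := by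
    ext y; simp
  rw [this]

def Bd : ℕ → ℕ → ℕ
  | 0, k => k
  | m + 1, k => max k (Bd m (Fintype.card (Nx k)))

lemma reg_iter (F : Bool → V × V → ℝ) (h0 : ∀ b w, 0 ≤ F b w) (h1 : ∀ b w, F b w ≤ 1)
    (ε : ℝ) (hε : 0 < ε) (m : ℕ) : ∀ (k : ℕ) (f : V → Fin k),
      (2 - m * ε ^ 5) * (Fintype.card V : ℝ) ^ 2 ≤ energy F f →
      ∃ k' ≤ Bd m k, ∃ g : V → Fin k', ∃ π : Fin k' → Fin k, (∀ v, f v = π (g v)) ∧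
        ∑ p ∈ irr F ε g, ((cls g p.1).card : ℝ) * (cls g p.2).card ≤ ε * (Fintype.card V : ℝ) ^ 2 := by
  have hfin : ∀ (k : ℕ) (f : V → Fin k), (¬ ∑ p ∈ irr F ε f, ((cls f p.1).card : ℝ) * (cls f p.2).card
      ≤ ε * (Fintype.card V : ℝ) ^ 2) → ∃ g : V → Fin (Fintype.card (Nx k)),
        ∃ π : Fin (Fintype.card (Nx k)) → Fin k, (∀ v, f v = π (g v)) ∧
        energy F f + ε ^ 5 * (Fintype.card V : ℝ) ^ 2 ≤ energy F g := by
    intro k f h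
    push Not at h
    obtain ⟨g, hg, he⟩ := reg_step F ε hε f h
    refine ⟨fun v => Fintype.equivFin _ (g v), fun c => ((Fintype.equivFin (Nx k)).symm c).1, ?_, ?_⟩
    · intro v; simp [hg]
    · rw [energy_equiv]; exact he
  induction m with
  | zero =>
    intro k f hf
    refine ⟨k, le_rfl, f, id, fun _ => rfl, ?_⟩
    by_contra hcon
    obtain ⟨g, -, -, he⟩ := hfin k f hcon
    have := energy_le F h0 h1 g
    rcases Nat.eq_zero_or_pos (Fintype.card V) with hV | hV
    · apply hcon
      have : IsEmpty V := Fintype.card_eq_zero_iff.1 hV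
      rw [sum_eq_zero]
      · positivity
      · intro p _
        have : cls f p.1 = ∅ := by ext v; exact isEmptyElim v
        rw [this]; simp
    · have hV' : (0 : ℝ) < Fintype.card V := by exact_mod_cast hV
      have : 0 < ε ^ 5 * (Fintype.card V : ℝ) ^ 2 := by positivity
      push_cast at hf
      linarith
  | succ m ih =>
    intro k f hf
    by_cases hgood : ∑ p ∈ irr F ε f, ((cls f p.1).card : ℝ) * (cls f p.2).card
      ≤ ε * (Fintype.card V : ℝ) ^ 2
    · exact ⟨k, le_max_left _ _, f, id, fun _ => rfl, hgood⟩
    · obtain ⟨g, π, hg, he⟩ := hfin k f hgood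
      obtain ⟨k', hk', g', π', hg', hh⟩ := ih _ g (by push_cast at hf; linarith)
      exact ⟨k', hk'.trans (le_max_right _ _), g', fun c => π (π' c), fun v => by rw [hg, hg'], hh⟩

end reg

theorem regularity (ε : ℝ) (hε : 0 < ε) (k0 : ℕ) : ∃ K : ℕ, ∀ (n : ℕ) (F : Bool → Fin n × Fin n → ℝ),
    (∀ b w, 0 ≤ F b w) → (∀ b w, F b w ≤ 1) → ∀ f0 : Fin n → Fin k0,
    ∃ k ≤ K, ∃ f : Fin n → Fin k, ∃ π : Fin k → Fin k0, (∀ v, f0 v = π (f v)) ∧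
      ∑ p ∈ irr F ε f, ((cls f p.1).card : ℝ) * (cls f p.2).card ≤ ε * (n : ℝ) ^ 2 := by
  obtain ⟨m, hm⟩ := exists_nat_gt (2 / ε ^ 5)
  rw [div_lt_iff₀ (by positivity)] at hm
  refine ⟨Bd m k0, fun n F h0 h1 f0 => ?_⟩
  obtain ⟨k, hk, g, π, h, h'⟩ := reg_iter F h0 h1 ε hε m k0 f0 (by
    have : 0 ≤ energy F f0 := sum_nonneg fun b _ => sum_nonneg fun z _ => sq_nonneg _
    refine le_trans (mul_nonpos_of_nonpos_of_nonneg (by linarith) (by positivity)) this)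
  exact ⟨k, hk, g, π, h, by simpa using h'⟩

end RT36

end

section

open Finset

namespace RT36
set_option linter.unusedSectionVars false

section emb
variable {V : Type*} [Fintype V] [DecidableEq V]

open Classical in
noncomputable def ind (B : SimpleGraph V) : V × V → ℝ := fun z => if B.Adj z.1 z.2 then 1 else 0

lemma ind_nonneg (B : SimpleGraph V) (z : V × V) : 0 ≤ ind B z := by
  unfold ind; split_ifs <;> norm_num

lemma ind_le_one (B : SimpleGraph V) (z : V × V) : ind B z ≤ 1 := by
  unfold ind; split_ifs <;> norm_num

noncomputable def nb (B : SimpleGraph V) (v : V) (A : Finset V) : Finset V :=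
  haveI : DecidablePred (B.Adj v) := Classical.decPred _
  A.filter (B.Adj v)

lemma nb_sub (B : SimpleGraph V) (v : V) (A : Finset V) : nb B v A ⊆ A := by
  intro u hu
  simp only [nb, mem_filter] at hu
  exact hu.1

lemma eW_ind (B : SimpleGraph V) (X Y : Finset V) : eW (ind B) X Y = ∑ v ∈ X, ((nb B v Y).card : ℝ) := by
  classical
  unfold eW ind nb
  rw [sum_product]
  refine sum_congr rfl fun v _ => ?_
  simp

lemma dW_symm (B : SimpleGraph V) (X Y : Finset V) : dW (ind B) X Y = dW (ind B) Y X := by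
  unfold dW eW
  rw [sum_product, sum_product_right, mul_comm]
  congr 1
  refine sum_congr rfl fun v _ => sum_congr rfl fun u _ => ?_
  have := B.adj_comm v u
  by_cases h : B.Adj u v <;> simp [ind, h, this]

/-- few atypical vertices -/
lemma typical (B : SimpleGraph V) (ε : ℝ) (hε : 0 ≤ ε) (X Y A : Finset V) (h : RegW (ind B) ε X Y)
    (hA : A ⊆ Y) (hAc : ε * Y.card ≤ A.card) (Z : Finset V) (hZ : Z ⊆ X)
    (hbad : ∀ v ∈ Z, ((nb B v A).card : ℝ) < (dW (ind B) X Y - ε) * A.card) :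
    (Z.card : ℝ) ≤ ε * X.card := by
  by_contra hcon
  push Not at hcon
  have h1 := h Z hZ A hA hcon.le hAc
  have hZ0 : Z.Nonempty := by
    rw [← card_pos]
    have : (0 : ℝ) < Z.card := lt_of_le_of_lt (by positivity) hcon
    exact_mod_cast this
  have h2 : eW (ind B) Z A < (dW (ind B) X Y - ε) * (Z.card * A.card) := by
    rw [eW_ind]
    calc _ < ∑ v ∈ Z, (dW (ind B) X Y - ε) * A.card := sum_lt_sum_of_nonempty hZ0 hbad
      _ = _ := by rw [sum_const, nsmul_eq_mul]; ring
  have := (abs_le.1 h1).1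
  linarith

variable {ι : Type*}

lemma good_list (A : Finset V) (bad : ι → V → Prop) (c : ℝ) (r : List ι)
    (h : ∀ j ∈ r, ∀ Z ⊆ A, (∀ v ∈ Z, bad j v) → (Z.card : ℝ) ≤ c) :
    ∃ D ⊆ A, (A.card : ℝ) - r.length * c ≤ D.card ∧ ∀ v ∈ D, ∀ j ∈ r, ¬ bad j v := by
  classical
  induction r with
  | nil => exact ⟨A, Subset.rfl, by simp, by simp⟩
  | cons a r ih =>
    obtain ⟨D, hD, hc, hg⟩ := ih fun j hj => h j (List.mem_cons_of_mem _ hj)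
    refine ⟨D.filter fun v => ¬ bad a v, (filter_subset _ _).trans hD, ?_, ?_⟩
    · have h1 := h a List.mem_cons_self (D.filter fun v => bad a v) ((filter_subset _ _).trans hD)
        (fun v hv => (mem_filter.1 hv).2)
      have h2 : (#(D.filter fun v => bad a v) : ℝ) + #(D.filter fun v => ¬ bad a v) = #D := by
        exact_mod_cast card_filter_add_card_filter_not (s := D) (fun v => bad a v)
      simp only [List.length_cons]
      push_cast
      linarith
    · intro v hv j hj
      rw [mem_filter] at hv
      rcases List.mem_cons.1 hj with rfl | hj
      · exact hv.2
      · exact hg v hv.1 j hj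

/-- typical vertices to many sets -/
lemma typ_list (B : SimpleGraph V) (ε : ℝ) (hε : 0 ≤ ε) (X A : ι → Finset V) (i : ι) (r : List ι)
    (hAX : A i ⊆ X i)
    (hr : ∀ j ∈ r, RegW (ind B) ε (X i) (X j) ∧ A j ⊆ X j ∧ ε * (X j).card ≤ (A j).card ∧ 0 < (A j).card) :
    ∃ D ⊆ A i, ((A i).card : ℝ) - r.length * (ε * (X i).card) ≤ D.card ∧
      ∀ v ∈ D, ∀ j ∈ r, (dW (ind B) (X i) (X j) - ε) * (A j).card ≤ (nb B v (A j)).card := by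
  obtain ⟨D, h1, h2, h3⟩ := good_list (A i)
    (fun j v => ((nb B v (A j)).card : ℝ) < (dW (ind B) (X i) (X j) - ε) * (A j).card)
    (ε * (X i).card) r (by
      intro j hj Z hZ hb
      obtain ⟨a, b, c, -⟩ := hr j hj
      exact typical B ε hε (X i) (X j) (A j) a b c Z (hZ.trans hAX) hb)
  exact ⟨D, h1, h2, fun v hv j hj => not_lt.1 (h3 v hv j hj)⟩

lemma embed_q (B : SimpleGraph V) (X : ι → Finset V) (η ε κ ρ : ℝ) (hε : 0 < ε) (hκ : 0 < κ)
    (hρ : 0 < ρ) (hρ1 : ρ ≤ 1) (hρη : ρ ≤ 2 * η - 2 * ε) (hεκ : 12 * ε ≤ κ / 2) (q : List ι) :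
    ∀ A : ι → Finset V, q.length ≤ 12 →
    (∀ i ∈ q, 0 < (X i).card ∧ A i ⊆ X i ∧ κ * (1 / ρ) ^ q.length * (X i).card ≤ (A i).card ∧
      ∀ Z ⊆ A i, κ / 2 * (X i).card ≤ Z.card → ∃ u ∈ Z, ∃ v ∈ Z, B.Adj u v) →
    q.Pairwise (fun i j => RegW (ind B) ε (X i) (X j) ∧ 1 / 2 + η ≤ dW (ind B) (X i) (X j)) →
    ∃ T : Finset V, B.IsClique T ∧ T.card = 2 * q.length ∧ ∀ t ∈ T, ∃ i ∈ q, t ∈ A i := by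
  induction q with
  | nil => intro A _ _ _; exact ⟨∅, by simp, by simp, by simp⟩
  | cons i r ih =>
    intro A hlen hA hp
    rw [List.pairwise_cons] at hp
    simp only [List.length_cons] at hlen hA ⊢
    have hone : ∀ m : ℕ, 1 ≤ (1 / ρ) ^ m := fun m => one_le_pow₀ ((one_le_div hρ).2 hρ1)
    have hAk : ∀ j ∈ i :: r, κ * (X j).card ≤ (A j).card := by
      intro j hj
      refine le_trans ?_ (hA j hj).2.2.1
      have := hone (r.length + 1)
      have h0 : (0 : ℝ) ≤ (X j).card := Nat.cast_nonneg _
      refine mul_le_mul_of_nonneg_right ?_ h0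
      nlinarith
    have hApos : ∀ j ∈ i :: r, (0 : ℝ) < (A j).card := by
      intro j hj
      have := (hA j hj).1
      have h0 : (0 : ℝ) < (X j).card := by exact_mod_cast this
      exact lt_of_lt_of_le (by positivity) (hAk j hj)
    obtain ⟨D, hD, hDc, hDg⟩ := typ_list B ε hε.le X A i r (hA i List.mem_cons_self).2.1 (by
      intro j hj
      have hj' := List.mem_cons_of_mem i hj
      refine ⟨(hp.1 j hj).1, (hA j hj').2.1, le_trans ?_ (hAk j hj'), ?_⟩
      · exact mul_le_mul_of_nonneg_right (by linarith) (Nat.cast_nonneg _)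
      · exact_mod_cast hApos j hj')
    have hXi : (0 : ℝ) < (X i).card := by exact_mod_cast (hA i List.mem_cons_self).1
    have hrl : (r.length : ℝ) ≤ 12 := by exact_mod_cast (by omega : r.length ≤ 12)
    have hDk : κ / 2 * (X i).card ≤ D.card := by
      have := hAk i List.mem_cons_self
      have h1 : (r.length : ℝ) * (ε * (X i).card) ≤ κ / 2 * (X i).card := by
        rw [← mul_assoc]
        refine mul_le_mul_of_nonneg_right ?_ hXi.le
        nlinarith
      linarith
    obtain ⟨u, hu, v, hv, huv⟩ := (hA i List.mem_cons_self).2.2.2 D hD hDk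
    obtain ⟨T, hT, hTc, hTA⟩ := ih (fun j => nb B u (nb B v (A j))) (by omega) (by
      intro j hj
      have hj' := List.mem_cons_of_mem i hj
      obtain ⟨a, b, c, d⟩ := hA j hj'
      have hsub : nb B u (nb B v (A j)) ⊆ A j := (nb_sub _ _ _).trans (nb_sub _ _ _)
      refine ⟨a, hsub.trans b, ?_, fun Z hZ => d Z (hZ.trans hsub)⟩
      have h1 := hDg u hu j hj
      have h2 := hDg v hv j hj
      have h3 := (hp.1 j hj).2
      have h4 : nb B u (nb B v (A j)) = nb B u (A j) ∩ nb B v (A j) := by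
        ext x; simp [nb]; tauto
      have h5 : ((nb B u (A j)).card : ℝ) + (nb B v (A j)).card
          ≤ (nb B u (nb B v (A j))).card + (A j).card := by
        rw [h4]
        have h6 := card_union_add_card_inter (nb B u (A j)) (nb B v (A j))
        have h7 := card_le_card (union_subset (nb_sub B u (A j)) (nb_sub B v (A j)))
        exact_mod_cast (by omega : (nb B u (A j)).card + (nb B v (A j)).card
          ≤ (nb B u (A j) ∩ nb B v (A j)).card + (A j).card)
      have hpos := hApos j hj'
      have h6 : ρ * (A j).card ≤ (nb B u (nb B v (A j))).card := by
        have : (1 / 2 + η - ε) * (A j).card ≤ (dW (ind B) (X i) (X j) - ε) * (A j).card :=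
          mul_le_mul_of_nonneg_right (by linarith) hpos.le
        nlinarith
      refine le_trans ?_ h6
      calc κ * (1 / ρ) ^ r.length * (X j).card = ρ * (κ * (1 / ρ) ^ (r.length + 1) * (X j).card) := by
            rw [pow_succ]; field_simp
        _ ≤ _ := mul_le_mul_of_nonneg_left c hρ.le) hp.2
    have hTu : ∀ t ∈ T, B.Adj u t ∧ B.Adj v t ∧ ∃ j ∈ r, t ∈ A j := by
      intro t ht
      obtain ⟨j, hj, htj⟩ := hTA t ht
      simp only [nb, mem_filter] at htj
      exact ⟨htj.2, htj.1.2, j, hj, htj.1.1⟩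
    have hvT : v ∉ T := fun h => (hTu v h).2.1.ne rfl
    have huT : u ∉ insert v T := by
      rw [mem_insert]
      rintro (h | h)
      · exact huv.ne h
      · exact (hTu u h).1.ne rfl
    refine ⟨insert u (insert v T), ?_, ?_, ?_⟩
    · rw [coe_insert, coe_insert, SimpleGraph.isClique_insert, SimpleGraph.isClique_insert]
      refine ⟨⟨hT, fun b hb _ => (hTu b hb).2.1⟩, fun b hb _ => ?_⟩
      rcases hb with rfl | hb
      · exact huv
      · exact (hTu b hb).1
    · rw [card_insert_of_notMem huT, card_insert_of_notMem hvT, hTc]; ring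
    · intro t ht
      rw [mem_insert, mem_insert] at ht
      rcases ht with rfl | rfl | ht
      · exact ⟨i, List.mem_cons_self, hD hu⟩
      · exact ⟨i, List.mem_cons_self, hD hv⟩
      · obtain ⟨-, -, j, hj, h⟩ := hTu t ht
        exact ⟨j, List.mem_cons_of_mem _ hj, h⟩

lemma embed (B : SimpleGraph V) (X : ι → Finset V) (η ε κ ρ : ℝ) (hε : 0 < ε) (hκ : 0 < κ)
    (hρ : 0 < ρ) (hρ1 : ρ ≤ 1) (hρη : ρ ≤ η - ε) (hεκ : 12 * ε ≤ κ / 2) (q : List ι) (l : List ι) :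
    ∀ A : ι → Finset V, l.length + q.length ≤ 12 →
    (∀ i ∈ l ++ q, 0 < (X i).card ∧ A i ⊆ X i ∧
      κ * (1 / ρ) ^ (l.length + q.length) * (X i).card ≤ (A i).card) →
    (∀ i ∈ q, ∀ Z ⊆ A i, κ / 2 * (X i).card ≤ Z.card → ∃ u ∈ Z, ∃ v ∈ Z, B.Adj u v) →
    l.Pairwise (fun i j => RegW (ind B) ε (X i) (X j) ∧ η ≤ dW (ind B) (X i) (X j)) →
    (∀ i ∈ l, ∀ j ∈ q, RegW (ind B) ε (X i) (X j) ∧ η ≤ dW (ind B) (X i) (X j)) →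
    q.Pairwise (fun i j => RegW (ind B) ε (X i) (X j) ∧ 1 / 2 + η ≤ dW (ind B) (X i) (X j)) →
    ∃ T : Finset V, B.IsClique T ∧ T.card = l.length + 2 * q.length ∧ ∀ t ∈ T, ∃ i ∈ l ++ q, t ∈ A i := by
  induction l with
  | nil =>
    intro A h1 h2 h3 _ _ h4
    simp only [List.length_nil, zero_add, List.nil_append] at *
    exact embed_q B X η ε κ ρ hε hκ hρ hρ1 (by linarith) hεκ q A h1
      (fun i hi => ⟨(h2 i hi).1, (h2 i hi).2.1, (h2 i hi).2.2, h3 i hi⟩) h4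
  | cons i l ih =>
    intro A hlen hA hZ hp hlq hq
    rw [List.pairwise_cons] at hp
    rw [List.cons_append] at hA
    simp only [List.length_cons] at hlen hA ⊢
    set r := l ++ q with hr
    have hone : ∀ m : ℕ, 1 ≤ (1 / ρ) ^ m := fun m => one_le_pow₀ ((one_le_div hρ).2 hρ1)
    have hAk : ∀ j ∈ i :: r, κ * (X j).card ≤ (A j).card := by
      intro j hj
      refine le_trans ?_ (hA j hj).2.2
      have := hone (l.length + 1 + q.length)
      have h0 : (0 : ℝ) ≤ (X j).card := Nat.cast_nonneg _
      refine mul_le_mul_of_nonneg_right ?_ h0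
      nlinarith
    have hApos : ∀ j ∈ i :: r, (0 : ℝ) < (A j).card := by
      intro j hj
      have := (hA j hj).1
      have h0 : (0 : ℝ) < (X j).card := by exact_mod_cast this
      exact lt_of_lt_of_le (by positivity) (hAk j hj)
    have hreg : ∀ j ∈ r, RegW (ind B) ε (X i) (X j) ∧ η ≤ dW (ind B) (X i) (X j) := by
      intro j hj
      rcases List.mem_append.1 hj with h | h
      · exact hp.1 j h
      · exact hlq i List.mem_cons_self j h
    obtain ⟨D, hD, hDc, hDg⟩ := typ_list B ε hε.le X A i r (hA i List.mem_cons_self).2.1 (by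
      intro j hj
      have hj' := List.mem_cons_of_mem i hj
      refine ⟨(hreg j hj).1, (hA j hj').2.1, le_trans ?_ (hAk j hj'), ?_⟩
      · exact mul_le_mul_of_nonneg_right (by linarith) (Nat.cast_nonneg _)
      · exact_mod_cast hApos j hj')
    have hXi : (0 : ℝ) < (X i).card := by exact_mod_cast (hA i List.mem_cons_self).1
    have hrl : (r.length : ℝ) ≤ 12 := by
      have : r.length ≤ 12 := by rw [hr, List.length_append]; omega
      exact_mod_cast this
    have hDk : κ / 2 * (X i).card ≤ D.card := by
      have := hAk i List.mem_cons_self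
      have h1 : (r.length : ℝ) * (ε * (X i).card) ≤ κ / 2 * (X i).card := by
        rw [← mul_assoc]
        refine mul_le_mul_of_nonneg_right ?_ hXi.le
        nlinarith
      linarith
    have hDne : D.Nonempty := by
      rw [← card_pos]
      have : (0 : ℝ) < D.card := lt_of_lt_of_le (by positivity) hDk
      exact_mod_cast this
    obtain ⟨u, hu⟩ := hDne
    obtain ⟨T, hT, hTc, hTA⟩ := ih (fun j => nb B u (A j)) (by omega) (by
      intro j hj
      have hj' := List.mem_cons_of_mem i hj
      obtain ⟨a, b, c⟩ := hA j hj'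
      refine ⟨a, (nb_sub _ _ _).trans b, ?_⟩
      have h1 := hDg u hu j hj
      have h3 := (hreg j hj).2
      have hpos := hApos j hj'
      have h6 : ρ * (A j).card ≤ (nb B u (A j)).card :=
        le_trans (mul_le_mul_of_nonneg_right (by linarith) hpos.le) h1
      refine le_trans ?_ h6
      calc κ * (1 / ρ) ^ (l.length + q.length) * (X j).card
          = ρ * (κ * (1 / ρ) ^ (l.length + 1 + q.length) * (X j).card) := by
            rw [show l.length + 1 + q.length = (l.length + q.length) + 1 by ring, pow_succ]; field_simp
        _ ≤ _ := mul_le_mul_of_nonneg_left c hρ.le)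
      (fun j hj Z hZj => hZ j hj Z (hZj.trans (nb_sub _ _ _))) hp.2
      (fun a ha => hlq a (List.mem_cons_of_mem _ ha)) hq
    have hTu : ∀ t ∈ T, B.Adj u t ∧ ∃ j ∈ r, t ∈ A j := by
      intro t ht
      obtain ⟨j, hj, htj⟩ := hTA t ht
      simp only [nb, mem_filter] at htj
      exact ⟨htj.2, j, hj, htj.1⟩
    have huT : u ∉ T := fun h => (hTu u h).1.ne rfl
    refine ⟨insert u T, ?_, ?_, ?_⟩
    · rw [coe_insert, SimpleGraph.isClique_insert]
      exact ⟨hT, fun b hb _ => (hTu b hb).1⟩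
    · rw [card_insert_of_notMem huT, hTc]; ring
    · intro t ht
      rw [mem_insert] at ht
      rcases ht with rfl | ht
      · exact ⟨i, List.mem_cons_self, hD hu⟩
      · obtain ⟨-, j, hj, h⟩ := hTu t ht
        exact ⟨j, List.mem_cons_of_mem _ hj, h⟩

end emb
end RT36

end

section

open Finset

namespace RT36
set_option linter.unusedSectionVars false

section mk
variable {n k : ℕ} (Rd Bl : SimpleGraph (Fin n)) (f : Fin n → Fin k) (ρ γ : ℝ)

noncomputable def FF : Bool → Fin n × Fin n → ℝ := fun b => ind (if b then Rd else Bl)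

noncomputable def epsR (ρ : ℝ) : ℝ := ρ ^ 13 / 24

def Rg (i j : Fin k) : Prop :=
  i ≠ j ∧ γ * n ≤ (cls f i).card ∧ γ * n ≤ (cls f j).card ∧
    (i, j) ∉ irr (FF Rd Bl) (epsR ρ) f ∧ (j, i) ∉ irr (FF Rd Bl) (epsR ρ) f

lemma Rg_symm {i j : Fin k} (h : Rg Rd Bl f ρ γ i j) : Rg Rd Bl f ρ γ j i :=
  ⟨h.1.symm, h.2.2.1, h.2.1, h.2.2.2.2, h.2.2.2.1⟩

lemma Rg_reg {i j : Fin k} (h : Rg Rd Bl f ρ γ i j) :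
    RegW (ind Rd) (epsR ρ) (cls f i) (cls f j) ∧ RegW (ind Bl) (epsR ρ) (cls f i) (cls f j) := by
  classical
  have h1 := h.2.2.2.1
  unfold irr at h1
  rw [mem_filter] at h1
  push Not at h1
  have h2 := h1 (mem_univ _)
  exact ⟨h2 true, h2 false⟩

lemma kap (ρ : ℝ) (hρ : 0 < ρ) (hρ1 : ρ ≤ 1 / 4) (m : ℕ) (hm : m ≤ 12) : ρ ^ 13 * (1 / ρ) ^ m ≤ ρ := by
  have : ρ ^ 13 * (1 / ρ) ^ m = ρ * ρ ^ (12 - m) := by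
    rw [one_div, inv_pow, ← div_eq_mul_inv, div_eq_iff (by positivity), mul_assoc, ← pow_add,
      Nat.sub_add_cancel hm]
    ring
  rw [this]
  have := pow_le_one₀ (n := 12 - m) hρ.le (by linarith)
  nlinarith

lemma pairwise_two {α : Type*} {r : α → α → Prop} {L : List α} (h : L.Pairwise r) (h2 : 2 ≤ L.length)
    {i : α} (hi : i ∈ L) : ∃ j, r i j ∨ r j i := by
  match L, h, h2, hi with
  | a :: b :: t, h, _, hi =>
    rw [List.pairwise_cons] at h
    rcases List.mem_cons.1 hi with rfl | hi
    · exact ⟨b, Or.inl (h.1 b List.mem_cons_self)⟩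
    · exact ⟨a, Or.inr (h.1 i hi)⟩

lemma exists_sys (hn : 0 < n) (hρ : 0 < ρ) (hρ1 : ρ ≤ 1 / 4) (hγ : 0 < γ) (δ : ℝ)
    (hδ : δ < ρ ^ 13 / 2 * γ) (hR3 : Rd.CliqueFree 3) (hB6 : Bl.CliqueFree 6)
    (hind : ∀ s : Finset (Fin n), (∀ x ∈ s, ∀ y ∈ s, ¬ Rd.Adj x y ∧ ¬ Bl.Adj x y) → (s.card : ℝ) ≤ δ * n) :
    ∃ s : Sys (Fin k), (∀ i j, s.red i j ↔ Rg Rd Bl f ρ γ i j ∧ 2 * ρ ≤ dW (ind Rd) (cls f i) (cls f j)) ∧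
      (∀ i j, s.bl i j ↔ Rg Rd Bl f ρ γ i j ∧ 2 * ρ ≤ dW (ind Bl) (cls f i) (cls f j)) ∧
      (∀ i j, s.fb i j ↔ Rg Rd Bl f ρ γ i j ∧ 1 / 2 + 2 * ρ ≤ dW (ind Bl) (cls f i) (cls f j)) := by
  classical
  have hn' : (0 : ℝ) < n := by exact_mod_cast hn
  have hp12 : ρ ^ 12 ≤ 1 := pow_le_one₀ hρ.le (by linarith)
  have hp13 : ρ ^ 13 ≤ ρ := by rw [pow_succ]; nlinarith
  have h13 : 0 < ρ ^ 13 := by positivity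
  have hepos : 0 < epsR ρ := by unfold epsR; positivity
  have heρ : epsR ρ ≤ ρ := by unfold epsR; linarith
  have he12 : 12 * epsR ρ ≤ ρ ^ 13 / 2 := by unfold epsR; linarith
  have hbig : ∀ i j, Rg Rd Bl f ρ γ i j → 0 < (cls f i).card := by
    intro i j h
    have : (0 : ℝ) < (cls f i).card := lt_of_lt_of_le (by positivity) h.2.1
    exact_mod_cast this
  refine ⟨{
    R := fun i => ∀ A ⊆ cls f i, ρ * (cls f i).card ≤ A.card → ∃ u ∈ A, ∃ v ∈ A, Rd.Adj u v
    red := fun i j => Rg Rd Bl f ρ γ i j ∧ 2 * ρ ≤ dW (ind Rd) (cls f i) (cls f j)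
    bl := fun i j => Rg Rd Bl f ρ γ i j ∧ 2 * ρ ≤ dW (ind Bl) (cls f i) (cls f j)
    fb := fun i j => Rg Rd Bl f ρ γ i j ∧ 1 / 2 + 2 * ρ ≤ dW (ind Bl) (cls f i) (cls f j)
    red_symm := fun i j h => ⟨Rg_symm _ _ _ _ _ h.1, by rw [dW_symm]; exact h.2⟩
    bl_symm := fun i j h => ⟨Rg_symm _ _ _ _ _ h.1, by rw [dW_symm]; exact h.2⟩
    fb_symm := fun i j h => ⟨Rg_symm _ _ _ _ _ h.1, by rw [dW_symm]; exact h.2⟩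
    red_irr := fun i h => h.1.1 rfl
    bl_irr := fun i h => h.1.1 rfl
    fb_bl := fun i j h => ⟨h.1, by linarith [h.2]⟩
    red_tri := ?_
    red_R := ?_
    noclq := ?_ }, fun _ _ => Iff.rfl, fun _ _ => Iff.rfl, fun _ _ => Iff.rfl⟩
  · intro a b c hab hbc hac
    obtain ⟨T, hT, hTc, -⟩ := embed Rd (cls f) (2 * ρ) (epsR ρ) (ρ ^ 13) ρ hepos h13 hρ (by linarith)
      (by linarith) he12 [] [a, b, c] (cls f) (by simp) (by
        intro i hi
        refine ⟨?_, Subset.rfl, ?_⟩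
        · simp at hi
          rcases hi with rfl | rfl | rfl
          · exact hbig _ _ hab.1
          · exact hbig _ _ hbc.1
          · exact hbig _ _ (Rg_symm _ _ _ _ _ hbc.1)
        · have := kap ρ hρ hρ1 3 (by norm_num)
          simp only [List.length_cons, List.length_nil]
          norm_num at this ⊢
          refine mul_le_of_le_one_left (Nat.cast_nonneg _) (by linarith))
      (by simp) (by
        simp only [List.pairwise_cons, List.mem_cons, List.not_mem_nil]
        refine ⟨?_, ?_, by simp, by simp⟩
        · rintro j (rfl | rfl | h)
          · exact ⟨(Rg_reg _ _ _ _ _ hab.1).1, hab.2⟩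
          · exact ⟨(Rg_reg _ _ _ _ _ hac.1).1, hac.2⟩
          · exact h.elim
        · rintro j (rfl | h)
          · exact ⟨(Rg_reg _ _ _ _ _ hbc.1).1, hbc.2⟩
          · exact h.elim) (by simp) (by simp)
    exact hR3 T ⟨hT, by simpa using hTc⟩
  · intro i j hR hij
    have hji := Rg_symm _ _ _ _ _ hij.1
    obtain ⟨D, hD, hDc, hDg⟩ := typ_list Rd (epsR ρ) hepos.le (cls f) (cls f) j [i] Subset.rfl (by
      intro a ha
      simp at ha
      subst ha
      refine ⟨(Rg_reg _ _ _ _ _ hji).1, Subset.rfl, ?_, hbig _ _ hij.1⟩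
      exact mul_le_of_le_one_left (Nat.cast_nonneg _) (by linarith))
    have hj0 : (0 : ℝ) < (cls f j).card := by exact_mod_cast hbig _ _ hji
    have hDne : D.Nonempty := by
      rw [← card_pos]
      have : (0 : ℝ) < D.card := by
        simp only [List.length_cons, List.length_nil] at hDc
        push_cast at hDc
        nlinarith
      exact_mod_cast this
    obtain ⟨v, hv⟩ := hDne
    have h1 := hDg v hv i (by simp)
    obtain ⟨u, hu, u', hu', huu⟩ := hR (nb Rd v (cls f i)) (nb_sub _ _ _) (by
      refine le_trans (mul_le_mul_of_nonneg_right ?_ (Nat.cast_nonneg _)) h1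
      rw [dW_symm]
      linarith [hij.2])
    simp only [nb, mem_filter] at hu hu'
    refine hR3 {v, u, u'} ?_
    rw [SimpleGraph.is3Clique_triple_iff]
    exact ⟨hu.2, hu'.2, huu⟩
  · intro l q hl hq hqR hlq hlen
    have hX : ∀ i, ∃ A ⊆ cls f i, (¬ (∀ A ⊆ cls f i, ρ * (cls f i).card ≤ A.card →
        ∃ u ∈ A, ∃ v ∈ A, Rd.Adj u v) → ∀ u ∈ A, ∀ v ∈ A, ¬ Rd.Adj u v) ∧
        ρ * (cls f i).card ≤ A.card := by
      intro i
      by_cases h : ∀ A ⊆ cls f i, ρ * (cls f i).card ≤ A.card → ∃ u ∈ A, ∃ v ∈ A, Rd.Adj u v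
      · exact ⟨cls f i, Subset.rfl, fun h' => absurd h h',
          mul_le_of_le_one_left (Nat.cast_nonneg _) (by linarith)⟩
      · have h' := h
        push Not at h'
        obtain ⟨A, h1, h2, h3⟩ := h'
        exact ⟨A, h1, fun _ => h3, h2⟩
    choose A hA1 hA2 hA3 using hX
    have hl' : (l.take 6).Pairwise _ := hl.sublist (List.take_sublist 6 l)
    have hq' : (q.take 6).Pairwise _ := hq.sublist (List.take_sublist 6 q)
    have hml : ∀ i ∈ l.take 6, i ∈ l := fun i hi => List.mem_of_mem_take hi
    have hmq : ∀ i ∈ q.take 6, i ∈ q := fun i hi => List.mem_of_mem_take hi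
    have htl : (l.take 6).length + (q.take 6).length ≤ 12 := by
      simp only [List.length_take]; omega
    by_cases hall : ∀ i ∈ l.take 6 ++ q.take 6, γ * n ≤ (cls f i).card
    · have hpos : ∀ i ∈ l.take 6 ++ q.take 6, 0 < (cls f i).card := by
        intro i hi
        have : (0 : ℝ) < (cls f i).card := lt_of_lt_of_le (by positivity) (hall i hi)
        exact_mod_cast this
      obtain ⟨T, hT, hTc, -⟩ := embed Bl (cls f) (2 * ρ) (epsR ρ) (ρ ^ 13) ρ hepos h13 hρ (by linarith)
        (by linarith) he12 (q.take 6) (l.take 6) A htl (by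
          intro i hi
          refine ⟨hpos i hi, hA1 i, le_trans ?_ (hA3 i)⟩
          exact mul_le_mul_of_nonneg_right (kap ρ hρ hρ1 _ htl) (Nat.cast_nonneg _))
        (by
          intro i hi Z hZ hZc
          by_contra hcon
          push Not at hcon
          have h1 := hind Z fun x hx y hy =>
            ⟨hA2 i (hqR i (hmq i hi)) x (hZ hx) y (hZ hy), hcon x hx y hy⟩
          have h2 := hall i (List.mem_append_right _ hi)
          have h3 : ρ ^ 13 / 2 * (γ * n) ≤ ρ ^ 13 / 2 * (cls f i).card :=
            mul_le_mul_of_nonneg_left h2 (by positivity)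
          nlinarith)
        (hl'.imp fun h => ⟨(Rg_reg _ _ _ _ _ h.1).2, h.2⟩)
        (fun i hi j hj => by
          have h := hlq i (hml i hi) j (hmq j hj)
          exact ⟨(Rg_reg _ _ _ _ _ h.1).2, h.2⟩)
        (hq'.imp fun h => ⟨(Rg_reg _ _ _ _ _ h.1).2, h.2⟩)
      have h6 : 6 ≤ T.card := by
        rw [hTc]
        simp only [List.length_take]; omega
      exact hB6.mono h6 T ⟨hT, rfl⟩
    · apply hall
      intro i hi
      have hi' : i ∈ l ++ q := by
        rcases List.mem_append.1 hi with h | h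
        · exact List.mem_append_left _ (hml i h)
        · exact List.mem_append_right _ (hmq i h)
      have hpw : (l ++ q).Pairwise (Rg Rd Bl f ρ γ) := by
        rw [List.pairwise_append]
        exact ⟨hl.imp fun h => h.1, hq.imp fun h => h.1, fun a ha b hb => (hlq a ha b hb).1⟩
      rcases pairwise_two hpw (by rw [List.length_append]; omega) hi' with ⟨j, h | h⟩
      · exact h.2.1
      · exact h.2.2.1

end mk
end RT36

end

section

open Finset

namespace RT36
set_option linter.unusedSectionVars false

lemma two_edges {n : ℕ} (G : SimpleGraph (Fin n)) : ∑ z, ind G z = 2 * (G.edgeSet.ncard : ℝ) := by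
  classical
  have h := G.sum_degrees_eq_twice_card_edges
  rw [Set.ncard_eq_toFinset_card' G.edgeSet]
  have h2 : G.edgeSet.toFinset.card = G.edgeFinset.card := by
    congr 1
  rw [h2]
  have h3 : ((∑ v, G.degree v : ℕ) : ℝ) = ((2 * G.edgeFinset.card : ℕ) : ℝ) := by rw [h]
  push_cast at h3
  rw [← h3, Fintype.sum_prod_type]
  refine sum_congr rfl fun v _ => ?_
  unfold ind
  rw [← G.card_neighborFinset_eq_degree, G.neighborFinset_eq_filter]
  simp

lemma sum_pairs {n k : ℕ} (f : Fin n → Fin k) (F : Fin n × Fin n → ℝ) :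
    ∑ z, F z = ∑ i, ∑ j, eW F (cls f i) (cls f j) := by
  rw [← sum_fiberwise univ (fun z : Fin n × Fin n => (f z.1, f z.2)), Fintype.sum_prod_type]
  refine sum_congr rfl fun i _ => sum_congr rfl fun j _ => ?_
  unfold eW
  refine sum_congr ?_ fun _ _ => rfl
  ext ⟨u, v⟩
  simp [mem_cls]

lemma sum_cls {n k : ℕ} (f : Fin n → Fin k) : ∑ i, ((cls f i).card : ℝ) = n := by
  have := card_eq_sum_card_fiberwise (s := (univ : Finset (Fin n))) (t := univ) (f := f) (fun _ _ => by simp)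
  simp only [card_univ, Fintype.card_fin] at this
  rw [← Nat.cast_sum]
  exact_mod_cast this.symm

lemma eW_le {n : ℕ} (F : Fin n × Fin n → ℝ) (h : ∀ z, F z ≤ 1) (X Y : Finset (Fin n)) :
    eW F X Y ≤ X.card * Y.card := by
  unfold eW
  calc _ ≤ ∑ z ∈ X ×ˢ Y, (1 : ℝ) := sum_le_sum fun z _ => h z
    _ = _ := by rw [sum_const, card_product]; simp

lemma eW_dW {n : ℕ} (F : Fin n × Fin n → ℝ) (X Y : Finset (Fin n)) (hX : 0 < X.card) (hY : 0 < Y.card) :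
    eW F X Y = dW F X Y * (X.card * Y.card) := by
  unfold dW
  have h1 : (X.card : ℝ) ≠ 0 := by exact_mod_cast hX.ne'
  have h2 : (Y.card : ℝ) ≠ 0 := by exact_mod_cast hY.ne'
  field_simp

section asm
variable {n k : ℕ} (Rd Bl : SimpleGraph (Fin n)) (f : Fin n → Fin k) (ρ γ : ℝ)

open Classical in
noncomputable def JJ (i j : Fin k) : ℝ :=
  (if i = j then 1 else 0) + (if (i, j) ∈ irr (FF Rd Bl) (epsR ρ) f then 1 else 0)
  + (if (j, i) ∈ irr (FF Rd Bl) (epsR ρ) f then 1 else 0)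
  + (if γ * n ≤ (cls f i).card then 0 else 1) + (if γ * n ≤ (cls f j).card then 0 else 1)

lemma JJ_nonneg (i j : Fin k) : 0 ≤ JJ Rd Bl f ρ γ i j := by
  unfold JJ
  refine add_nonneg (add_nonneg (add_nonneg (add_nonneg ?_ ?_) ?_) ?_) ?_ <;>
    split_ifs <;> norm_num

lemma JJ_ge (i j : Fin k) (h : ¬ Rg Rd Bl f ρ γ i j) : 1 ≤ JJ Rd Bl f ρ γ i j := by
  by_contra hcon
  apply h
  unfold JJ at hcon
  unfold Rg
  split_ifs at hcon <;> first | (exfalso; norm_num at hcon; done) | tauto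

lemma JJ_sum (hγ : 0 ≤ γ) (K : ℕ) (hk : k ≤ K) (μ : ℝ) (hμ : ∀ i, ((cls f i).card : ℝ) ≤ μ * n)
    (hirr : ∑ p ∈ irr (FF Rd Bl) (epsR ρ) f, ((cls f p.1).card : ℝ) * (cls f p.2).card ≤ epsR ρ * (n : ℝ) ^ 2) :
    ∑ i, ∑ j, ((cls f i).card : ℝ) * (cls f j).card * JJ Rd Bl f ρ γ i j
      ≤ (μ + 2 * epsR ρ + 2 * K * γ) * (n : ℝ) ^ 2 := by
  classical
  set x : Fin k → ℝ := fun i => ((cls f i).card : ℝ) with hx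
  have hx0 : ∀ i, 0 ≤ x i := fun i => Nat.cast_nonneg _
  have hxs : ∑ i, x i = n := sum_cls f
  have h1 : ∑ i, ∑ j, x i * x j * (if i = j then 1 else 0) ≤ μ * (n : ℝ) ^ 2 := by
    simp only [mul_ite, mul_one, mul_zero, sum_ite_eq, mem_univ, if_true]
    calc ∑ i, x i * x i ≤ ∑ i, (μ * n) * x i := sum_le_sum fun i _ => mul_le_mul_of_nonneg_right (hμ i) (hx0 i)
      _ = _ := by rw [← mul_sum, hxs]; ring
  have h2 : ∑ i, ∑ j, x i * x j * (if (i, j) ∈ irr (FF Rd Bl) (epsR ρ) f then 1 else 0)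
      ≤ epsR ρ * (n : ℝ) ^ 2 := by
    refine le_trans (le_of_eq ?_) hirr
    rw [← Fintype.sum_prod_type' (f := fun i j => x i * x j * (if (i, j) ∈ irr (FF Rd Bl) (epsR ρ) f then 1 else 0))]
    simp only [mul_ite, mul_one, mul_zero, Prod.mk.eta]
    rw [sum_ite_mem, univ_inter]
  have h3 : ∑ i, ∑ j, x i * x j * (if (j, i) ∈ irr (FF Rd Bl) (epsR ρ) f then 1 else 0)
      ≤ epsR ρ * (n : ℝ) ^ 2 := by
    rw [sum_comm]
    refine le_trans (le_of_eq ?_) h2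
    refine sum_congr rfl fun i _ => sum_congr rfl fun j _ => ?_
    rw [mul_comm (x j)]
  have h4 : ∑ i, ∑ j, x i * x j * (if γ * n ≤ (cls f i).card then 0 else 1) ≤ K * γ * (n : ℝ) ^ 2 := by
    calc _ ≤ ∑ i : Fin k, ∑ j, (γ * n) * x j := by
          refine sum_le_sum fun i _ => sum_le_sum fun j _ => ?_
          split_ifs with h
          · rw [mul_zero]; exact mul_nonneg (by positivity) (hx0 j)
          · rw [mul_one]; push Not at h; exact mul_le_mul_of_nonneg_right h.le (hx0 j)
      _ = k * (γ * n * n) := by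
          simp_rw [← mul_sum, hxs]; simp; ring
      _ ≤ K * (γ * n * n) := by
          refine mul_le_mul_of_nonneg_right (by exact_mod_cast hk) (by positivity)
      _ = _ := by ring
  have h5 : ∑ i, ∑ j, x i * x j * (if γ * n ≤ (cls f j).card then 0 else 1) ≤ K * γ * (n : ℝ) ^ 2 := by
    rw [sum_comm]
    refine le_trans (le_of_eq ?_) h4
    refine sum_congr rfl fun i _ => sum_congr rfl fun j _ => ?_
    rw [mul_comm (x j)]
  have e : ∑ i, ∑ j, x i * x j * JJ Rd Bl f ρ γ i j
      = ∑ i, ∑ j, x i * x j * (if i = j then 1 else 0)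
      + ∑ i, ∑ j, x i * x j * (if (i, j) ∈ irr (FF Rd Bl) (epsR ρ) f then 1 else 0)
      + ∑ i, ∑ j, x i * x j * (if (j, i) ∈ irr (FF Rd Bl) (epsR ρ) f then 1 else 0)
      + ∑ i, ∑ j, x i * x j * (if γ * n ≤ (cls f i).card then 0 else 1)
      + ∑ i, ∑ j, x i * x j * (if γ * n ≤ (cls f j).card then 0 else 1) := by
    simp only [← sum_add_distrib]
    refine sum_congr rfl fun i _ => sum_congr rfl fun j _ => ?_
    unfold JJ
    ring
  rw [e]
  linarith

lemma ind_sup (h : Rd ⊓ Bl = ⊥) (z : Fin n × Fin n) : ind (Rd ⊔ Bl) z = ind Rd z + ind Bl z := by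
  have h1 : ¬ (Rd.Adj z.1 z.2 ∧ Bl.Adj z.1 z.2) := by
    intro h2
    have : (Rd ⊓ Bl).Adj z.1 z.2 := h2
    rw [h] at this
    exact this
  unfold ind
  by_cases a : Rd.Adj z.1 z.2 <;> by_cases b : Bl.Adj z.1 z.2 <;> simp [a, b] <;> tauto

lemma eW_sup (h : Rd ⊓ Bl = ⊥) (X Y : Finset (Fin n)) :
    eW (ind (Rd ⊔ Bl)) X Y = eW (ind Rd) X Y + eW (ind Bl) X Y := by
  unfold eW
  rw [← sum_add_distrib]
  exact sum_congr rfl fun z _ => ind_sup Rd Bl h z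

theorem assemble (h : Rd ⊓ Bl = ⊥) (hn : 0 < n) (hρ : 0 < ρ) (hρ1 : ρ ≤ 1 / 4) (hγ : 0 < γ) (δ : ℝ)
    (hδ : δ < ρ ^ 13 / 2 * γ) (hR3 : Rd.CliqueFree 3) (hB6 : Bl.CliqueFree 6)
    (hind : ∀ s : Finset (Fin n), (∀ x ∈ s, ∀ y ∈ s, ¬ Rd.Adj x y ∧ ¬ Bl.Adj x y) → (s.card : ℝ) ≤ δ * n)
    (ζ : ℝ) (hJ : ∑ i, ∑ j, ((cls f i).card : ℝ) * (cls f j).card * JJ Rd Bl f ρ γ i j ≤ ζ * (n : ℝ) ^ 2)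
    (θ : ℝ) (hθ : 0 < θ) (hθ' : θ ≤ 1 / 1000)
    (hE : (5 / 6 - θ ^ 2 + ζ + 4 * ρ) * (n : ℝ) ^ 2 ≤ ∑ z, ind (Rd ⊔ Bl) z) :
    ∃ c : Fin n → Fin 6, ∑ z : Fin n × Fin n, (if c z.1 = c z.2 then ind (Rd ⊔ Bl) z else 0)
      ≤ (ζ + 4 * ρ + 24 * θ) * (n : ℝ) ^ 2 := by
  classical
  obtain ⟨s, hred, hbl, hfb⟩ := exists_sys Rd Bl f ρ γ hn hρ hρ1 hγ δ hδ hR3 hB6 hind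
  set x : Fin k → ℝ := fun i => ((cls f i).card : ℝ) with hx
  have hn' : (0 : ℝ) < n := by exact_mod_cast hn
  have hx0 : ∀ i, 0 ≤ x i := fun i => Nat.cast_nonneg _
  have hxx0 : ∀ i j, 0 ≤ x i * x j := fun i j => mul_nonneg (hx0 i) (hx0 j)
  have hxs : ∑ i, x i = n := sum_cls f
  set a : Fin k → Fin k → ℝ := fun i j => eW (ind (Rd ⊔ Bl)) (cls f i) (cls f j) with ha
  have ha1 : ∀ i j, a i j ≤ x i * x j := fun i j => eW_le _ (ind_le_one _) _ _
  have hnot : ∀ i j, ¬ Rg Rd Bl f ρ γ i j → a i j ≤ x i * x j * JJ Rd Bl f ρ γ i j := by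
    intro i j hR
    have := JJ_ge Rd Bl f ρ γ i j hR
    have h1 := ha1 i j
    have h2 := hxx0 i j
    nlinarith
  have hden : ∀ i j, Rg Rd Bl f ρ γ i j →
      a i j = (dW (ind Rd) (cls f i) (cls f j) + dW (ind Bl) (cls f i) (cls f j)) * (x i * x j) := by
    intro i j hR
    have hi : 0 < (cls f i).card := by
      have : (0 : ℝ) < (cls f i).card := lt_of_lt_of_le (by positivity) hR.2.1
      exact_mod_cast this
    have hj : 0 < (cls f j).card := by
      have : (0 : ℝ) < (cls f j).card := lt_of_lt_of_le (by positivity) hR.2.2.1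
      exact_mod_cast this
    rw [ha]
    simp only
    rw [eW_sup Rd Bl h, eW_dW _ _ _ hi hj, eW_dW _ _ _ hi hj]
    ring
  have hJ0 := JJ_nonneg Rd Bl f ρ γ
  have claim0 : ∀ i j, ¬ s.red i j → ¬ s.bl i j → a i j ≤ x i * x j * (4 * ρ + JJ Rd Bl f ρ γ i j) := by
    intro i j h1 h2
    have hxx := hxx0 i j
    by_cases hR : Rg Rd Bl f ρ γ i j
    · rw [hred] at h1
      rw [hbl] at h2
      have h1' : dW (ind Rd) (cls f i) (cls f j) < 2 * ρ := by
        by_contra hc; exact h1 ⟨hR, not_lt.1 hc⟩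
      have h2' : dW (ind Bl) (cls f i) (cls f j) < 2 * ρ := by
        by_contra hc; exact h2 ⟨hR, not_lt.1 hc⟩
      rw [hden i j hR, mul_comm]
      refine mul_le_mul_of_nonneg_left ?_ hxx
      linarith [hJ0 i j]
    · refine (hnot i j hR).trans (mul_le_mul_of_nonneg_left ?_ hxx)
      linarith
  have claimA : ∀ i j, a i j ≤ x i * x j * (s.w i j + 4 * ρ + JJ Rd Bl f ρ γ i j) := by
    intro i j
    have hxx := hxx0 i j
    by_cases hR : Rg Rd Bl f ρ γ i j
    · rcases s.w_cases i j with hw | hw | hw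
      · rw [hw.2]
        have := ha1 i j
        have h3 : 0 ≤ x i * x j * (4 * ρ + JJ Rd Bl f ρ γ i j) :=
          mul_nonneg hxx (by linarith [hJ0 i j])
        nlinarith
      · rw [hw.2]
        have h1 : ¬ s.red i j := fun h' => hw.1.2 (Or.inl h')
        have h2 : ¬ s.fb i j := fun h' => hw.1.2 (Or.inr (Or.inl h'))
        rw [hred] at h1
        rw [hfb] at h2
        have h1' : dW (ind Rd) (cls f i) (cls f j) < 2 * ρ := by
          by_contra hc; exact h1 ⟨hR, not_lt.1 hc⟩
        have h2' : dW (ind Bl) (cls f i) (cls f j) < 1 / 2 + 2 * ρ := by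
          by_contra hc; exact h2 ⟨hR, not_lt.1 hc⟩
        rw [hden i j hR, mul_comm]
        refine mul_le_mul_of_nonneg_left ?_ hxx
        linarith [hJ0 i j]
      · have := s.w_zero hw
        rw [hw, zero_add]
        exact claim0 i j this.1 this.2
    · refine (hnot i j hR).trans (mul_le_mul_of_nonneg_left ?_ hxx)
      linarith [s.w_nonneg i j]
  have hxxs : ∑ i, ∑ j, x i * x j = (n : ℝ) ^ 2 := by
    simp_rw [← mul_sum, hxs, ← sum_mul, hxs]; ring
  have hquad : ∑ i, ∑ j, x i * x j * s.w i j = (n : ℝ) ^ 2 * quad s.w (fun i => (n : ℝ)⁻¹ * x i) := by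
    rw [Sys.quad_smul]
    unfold quad
    rw [← mul_assoc, ← mul_pow, mul_inv_cancel₀ hn'.ne', one_pow, one_mul]
    exact sum_congr rfl fun i _ => sum_congr rfl fun j _ => by ring
  have hq : 5 / 6 - θ ^ 2 ≤ quad s.w (fun i => (n : ℝ)⁻¹ * x i) := by
    have h1 : ∑ z, ind (Rd ⊔ Bl) z ≤ ∑ i, ∑ j, x i * x j * (s.w i j + 4 * ρ + JJ Rd Bl f ρ γ i j) := by
      rw [sum_pairs f]
      exact sum_le_sum fun i _ => sum_le_sum fun j _ => claimA i j
    have h2 : ∑ i, ∑ j, x i * x j * (s.w i j + 4 * ρ + JJ Rd Bl f ρ γ i j)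
        = ∑ i, ∑ j, x i * x j * s.w i j + 4 * ρ * ∑ i, ∑ j, x i * x j
          + ∑ i, ∑ j, x i * x j * JJ Rd Bl f ρ γ i j := by
      simp_rw [mul_sum]
      simp only [← sum_add_distrib]
      exact sum_congr rfl fun i _ => sum_congr rfl fun j _ => by ring
    rw [h2, hxxs, hquad] at h1
    have h3 : (n : ℝ) ^ 2 * (5 / 6 - θ ^ 2) ≤ (n : ℝ) ^ 2 * quad s.w (fun i => (n : ℝ)⁻¹ * x i) := by
      linarith
    exact le_of_mul_le_mul_left h3 (by positivity)
  obtain ⟨κ, E, hEs, hκ⟩ := s.stable (fun i => (n : ℝ)⁻¹ * x i)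
    (fun i => mul_nonneg (inv_nonneg.2 hn'.le) (hx0 i))
    (by rw [← mul_sum, hxs, inv_mul_cancel₀ hn'.ne']) θ hθ hθ' hq
  rw [← mul_sum, inv_mul_le_iff₀ hn'] at hEs
  refine ⟨fun v => κ (f v), ?_⟩
  rw [sum_pairs f]
  have claimB : ∀ i j, eW (fun z => if κ (f z.1) = κ (f z.2) then ind (Rd ⊔ Bl) z else 0) (cls f i) (cls f j)
      ≤ x i * x j * (4 * ρ + JJ Rd Bl f ρ γ i j) + ((if i ∈ E then x i * x j else 0)
        + (if j ∈ E then x i * x j else 0)) := by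
    intro i j
    have hxx := hxx0 i j
    have hnn : 0 ≤ x i * x j * (4 * ρ + JJ Rd Bl f ρ γ i j) := mul_nonneg hxx (by linarith [hJ0 i j])
    have e : eW (fun z => if κ (f z.1) = κ (f z.2) then ind (Rd ⊔ Bl) z else 0) (cls f i) (cls f j)
        = if κ i = κ j then a i j else 0 := by
      have : eW (fun z => if κ (f z.1) = κ (f z.2) then ind (Rd ⊔ Bl) z else 0) (cls f i) (cls f j)
        = ∑ z ∈ cls f i ×ˢ cls f j, if κ i = κ j then ind (Rd ⊔ Bl) z else 0 := by
        unfold eW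
        refine sum_congr rfl fun z hz => ?_
        rw [mem_product, mem_cls, mem_cls] at hz
        simp only [hz.1, hz.2]
      rw [this]
      split_ifs
      · rfl
      · simp
    rw [e]
    have := ha1 i j
    by_cases hi : i ∈ E
    · rw [if_pos hi]
      split_ifs <;> linarith
    · by_cases hj : j ∈ E
      · rw [if_pos hj, if_neg hi]
        split_ifs <;> linarith
      · rw [if_neg hi, if_neg hj]
        split_ifs with hκij
        · have := hκ i hi j hj hκij
          have := claim0 i j this.1 this.2
          linarith
        · linarith
  have hEi : ∑ i, ∑ j, (if i ∈ E then x i * x j else 0) ≤ 12 * θ * (n : ℝ) ^ 2 := by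
    have : ∑ i, ∑ j, (if i ∈ E then x i * x j else 0) = (∑ i ∈ E, x i) * n := by
      rw [sum_comm, sum_mul]
      simp only [sum_ite_mem, univ_inter]
      rw [sum_comm]
      refine sum_congr rfl fun i _ => ?_
      rw [← mul_sum, hxs]
    rw [this]
    nlinarith
  have hEj : ∑ i, ∑ j, (if j ∈ E then x i * x j else 0) ≤ 12 * θ * (n : ℝ) ^ 2 := by
    rw [sum_comm]
    refine le_trans (le_of_eq ?_) hEi
    refine sum_congr rfl fun i _ => sum_congr rfl fun j _ => ?_
    rw [mul_comm (x j)]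
  calc _ ≤ ∑ i, ∑ j, (x i * x j * (4 * ρ + JJ Rd Bl f ρ γ i j) + ((if i ∈ E then x i * x j else 0)
        + (if j ∈ E then x i * x j else 0))) := sum_le_sum fun i _ => sum_le_sum fun j _ => claimB i j
    _ = 4 * ρ * ∑ i, ∑ j, x i * x j + ∑ i, ∑ j, x i * x j * JJ Rd Bl f ρ γ i j
        + (∑ i, ∑ j, (if i ∈ E then x i * x j else 0) + ∑ i, ∑ j, (if j ∈ E then x i * x j else 0)) := by
      simp_rw [mul_sum]
      simp only [← sum_add_distrib]
      refine sum_congr rfl fun i _ => sum_congr rfl fun j _ => by ring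
    _ ≤ _ := by rw [hxxs]; linarith

end asm

lemma mod_cls (n k0 : ℕ) (hk0 : 0 < k0) (hn : k0 ≤ n) : ∃ f0 : Fin n → Fin k0, ∀ i,
    ((cls f0 i).card : ℝ) ≤ 2 / k0 * n := by
  refine ⟨fun v => ⟨v.1 % k0, Nat.mod_lt _ hk0⟩, fun i => ?_⟩
  have h1 : (cls (fun v : Fin n => (⟨v.1 % k0, Nat.mod_lt _ hk0⟩ : Fin k0)) i).card ≤ (range (n / k0 + 1)).card := by
    refine card_le_card_of_injOn (fun v => v.1 / k0) ?_ ?_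
    · intro v _
      simp only [coe_range, Set.mem_Iio]
      exact Nat.lt_succ_of_le (Nat.div_le_div_right v.2.le)
    · intro u hu v hv huv
      have hu' := congrArg Fin.val (mem_cls.1 hu)
      have hv' := congrArg Fin.val (mem_cls.1 hv)
      simp only at hu' hv' huv
      apply Fin.ext
      rw [← Nat.div_add_mod u.1 k0, ← Nat.div_add_mod v.1 k0, huv, hu', hv']
  rw [card_range] at h1
  have h2 : ((n / k0 : ℕ) : ℝ) ≤ n / k0 := Nat.cast_div_le
  have hk : (0 : ℝ) < k0 := by exact_mod_cast hk0
  have h3 : (1 : ℝ) ≤ n / k0 := by rw [le_div_iff₀ hk]; simpa using (by exact_mod_cast hn : (k0 : ℝ) ≤ n)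
  have h4 : ((cls (fun v : Fin n => (⟨v.1 % k0, Nat.mod_lt _ hk0⟩ : Fin k0)) i).card : ℝ) ≤ (n / k0 : ℕ) + 1 := by
    exact_mod_cast h1
  calc _ ≤ _ := h4
    _ ≤ (n : ℝ) / k0 + n / k0 := by linarith
    _ = _ := by ring

theorem near6 (ε : ℝ) (hε : 0 < ε) : ∃ δ : ℝ, 0 < δ ∧ ∃ N : ℕ, 0 < N ∧ ∀ n : ℕ, N ≤ n →
    ∀ G : SimpleGraph (Fin n),
      (∀ s : Finset (Fin n), (∀ x ∈ s, ∀ y ∈ s, x ≠ y → ¬ G.Adj x y) → (s.card : ℝ) ≤ δ * n) →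
      (∃ E₁ E₂ : SimpleGraph (Fin n), E₁ ⊔ E₂ = G ∧ E₁ ⊓ E₂ = ⊥ ∧ E₁.CliqueFree 3 ∧ E₂.CliqueFree 6) →
      (5 / 12 - δ) * n ^ 2 ≤ (G.edgeSet.ncard : ℝ) →
      ∃ c : Fin n → Fin 6, ∑ z : Fin n × Fin n, (if c z.1 = c z.2 then ind G z else 0) ≤ ε * (n : ℝ) ^ 2 := by
  set θ := min (1 / 1000) (ε / 100) with hθ
  have hθ0 : 0 < θ := lt_min (by norm_num) (by positivity)
  have hθ1 : θ ≤ 1 / 1000 := min_le_left _ _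
  have hθ2 : θ ≤ ε / 100 := min_le_right _ _
  have hθs : θ ^ 2 ≤ θ := by nlinarith
  set ρ := θ ^ 2 / 40 with hρ
  have hρ0 : 0 < ρ := by positivity
  have hρ1 : ρ ≤ 1 / 4 := by rw [hρ]; linarith
  have hρ12 : ρ ^ 12 ≤ 1 := pow_le_one₀ hρ0.le (by linarith)
  have heps : epsR ρ ≤ ρ := by
    unfold epsR
    rw [pow_succ]
    nlinarith
  have heps0 : 0 < epsR ρ := by unfold epsR; positivity
  obtain ⟨k0, hk0⟩ := exists_nat_gt (20 / θ ^ 2)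
  have hk0p : (0 : ℝ) < k0 := lt_trans (by positivity) hk0
  have hk0n : 0 < k0 := by exact_mod_cast hk0p
  have hk02 : 2 / (k0 : ℝ) ≤ θ ^ 2 / 10 := by
    rw [div_lt_iff₀ (by positivity)] at hk0
    rw [div_le_iff₀ hk0p]
    linarith
  obtain ⟨K, hK⟩ := regularity (epsR ρ) heps0 k0
  set γ := θ ^ 2 / (40 * (K + 1)) with hγ
  have hγ0 : 0 < γ := by positivity
  have hKγ : 2 * K * γ ≤ θ ^ 2 / 20 := by
    have h1 : γ * (40 * (K + 1)) = θ ^ 2 := div_mul_cancel₀ _ (by positivity)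
    nlinarith
  set δ := min (θ ^ 2 / 20) (ρ ^ 13 / 4 * γ) with hδ
  have hδ0 : 0 < δ := lt_min (by positivity) (by positivity)
  have hδ1 : δ ≤ θ ^ 2 / 20 := min_le_left _ _
  have hδ2 : δ ≤ ρ ^ 13 / 4 * γ := min_le_right _ _
  refine ⟨δ, hδ0, k0, hk0n, ?_⟩
  rintro n hn G hind ⟨Rd, Bl, rfl, hdis, hR3, hB6⟩ hE
  obtain ⟨f0, hf0⟩ := mod_cls n k0 hk0n hn
  obtain ⟨k, hk, f, π, hπ, hirr⟩ := hK n (FF Rd Bl) (fun b w => ind_nonneg _ _) (fun b w => ind_le_one _ _) f0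
  have hJ := JJ_sum Rd Bl f ρ γ hγ0.le K hk (2 / k0) (fun i => by
    refine le_trans ?_ (hf0 (π i))
    have : cls f i ⊆ cls f0 (π i) := by
      intro v hv
      rw [mem_cls] at hv ⊢
      rw [hπ, hv]
    exact_mod_cast card_le_card this) hirr
  have hn2 : 0 ≤ (n : ℝ) ^ 2 := by positivity
  have h13γ : 0 < ρ ^ 13 * γ := by positivity
  obtain ⟨c, hc⟩ := assemble Rd Bl f ρ γ hdis (by omega) hρ0 hρ1 hγ0 δ (by linarith) hR3 hB6
    (fun s hs => hind s fun x hx y hy _ hxy => by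
      rcases hxy with h | h
      · exact (hs x hx y hy).1 h
      · exact (hs x hx y hy).2 h) _ hJ θ hθ0 hθ1 (by
      rw [two_edges]
      refine le_trans ?_ (mul_le_mul_of_nonneg_left hE (by norm_num))
      rw [← mul_assoc]
      refine mul_le_mul_of_nonneg_right ?_ hn2
      linarith)
  refine ⟨c, hc.trans ?_⟩
  refine mul_le_mul_of_nonneg_right ?_ hn2
  linarith

end RT36

end

section

open Finset

namespace RT36
set_option linter.unusedSectionVars false

lemma same_sum {n : ℕ} (c : Fin n → Fin 6) :
    ∑ z : Fin n × Fin n, (if c z.1 = c z.2 then (1 : ℝ) else 0) = ∑ i, ((cls c i).card : ℝ) ^ 2 := by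
  rw [Fintype.sum_prod_type, ← sum_fiberwise univ c]
  refine sum_congr rfl fun i _ => ?_
  have : ∀ u ∈ univ.filter (fun u => c u = i), ∑ v, (if c u = c v then (1 : ℝ) else 0) = (cls c i).card := by
    intro u hu
    rw [(mem_filter.1 hu).2]
    unfold cls
    simp [eq_comm]
  rw [sum_congr rfl this, sum_const, nsmul_eq_mul, sq]
  rfl

/-- missing pairs and class sizes -/
lemma sizes {n : ℕ} (G : SimpleGraph (Fin n)) (c : Fin n → Fin 6) (δ ε τ : ℝ) (hτ : 0 < τ)
    (hs : 2 * δ + ε ≤ τ ^ 2)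
    (hE : (5 / 12 - δ) * n ^ 2 ≤ (G.edgeSet.ncard : ℝ))
    (hin : ∑ z : Fin n × Fin n, (if c z.1 = c z.2 then ind G z else 0) ≤ ε * (n : ℝ) ^ 2) :
    (∀ i, |((cls c i).card : ℝ) - n / 6| ≤ τ * n) ∧
    ∑ z : Fin n × Fin n, (if c z.1 = c z.2 then 0 else 1 - ind G z) ≤ τ ^ 2 * (n : ℝ) ^ 2 := by
  have hM : ∑ z : Fin n × Fin n, (if c z.1 = c z.2 then 0 else 1 - ind G z)
      = (n : ℝ) ^ 2 - ∑ i, ((cls c i).card : ℝ) ^ 2 - ∑ z, ind G z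
        + ∑ z : Fin n × Fin n, (if c z.1 = c z.2 then ind G z else 0) := by
    rw [← same_sum]
    have h1 : (n : ℝ) ^ 2 = ∑ z : Fin n × Fin n, (1 : ℝ) := by simp [sq]
    rw [h1, ← sum_sub_distrib, ← sum_sub_distrib, ← sum_add_distrib]
    refine sum_congr rfl fun z _ => ?_
    split_ifs <;> ring
  have hM0 : 0 ≤ ∑ z : Fin n × Fin n, (if c z.1 = c z.2 then 0 else 1 - ind G z) := by
    refine sum_nonneg fun z _ => ?_
    split_ifs
    · exact le_rfl
    · linarith [ind_le_one G z]
  have hvar : ∑ i, (((cls c i).card : ℝ) - n / 6) ^ 2 = ∑ i, ((cls c i).card : ℝ) ^ 2 - (n : ℝ) ^ 2 / 6 := by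
    have h1 := sum_cls c
    have h2 : ∀ i, (((cls c i).card : ℝ) - n / 6) ^ 2
        = ((cls c i).card : ℝ) ^ 2 - n / 3 * (cls c i).card + (n : ℝ) ^ 2 / 36 := fun i => by ring
    simp_rw [h2]
    rw [sum_add_distrib, sum_sub_distrib, ← mul_sum, h1]
    simp
    ring
  have h2e := two_edges G
  have hvar0 : 0 ≤ ∑ i, (((cls c i).card : ℝ) - n / 6) ^ 2 := sum_nonneg fun i _ => sq_nonneg _
  have hn2 : 0 ≤ (n : ℝ) ^ 2 := by positivity
  have hs' := mul_le_mul_of_nonneg_right hs hn2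
  constructor
  · intro i
    refine abs_le_of_sq_le_sq ?_ (by positivity)
    have h3 : (((cls c i).card : ℝ) - n / 6) ^ 2 ≤ ∑ i, (((cls c i).card : ℝ) - n / 6) ^ 2 :=
      single_le_sum (f := fun i => (((cls c i).card : ℝ) - n / 6) ^ 2) (fun i _ => sq_nonneg _) (mem_univ i)
    rw [mul_pow]
    linarith
  · linarith

lemma exists_perm {n : ℕ} (c c' : Fin n → Fin 6) : ∃ σ : Equiv.Perm (Fin n),
    ((univ.filter fun v => c' (σ v) ≠ c v).card : ℝ)
      ≤ ∑ i, |((cls c i).card : ℝ) - (cls c' i).card| := by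
  classical
  obtain ⟨σ, -, hmax⟩ := exists_max_image (univ : Finset (Equiv.Perm (Fin n)))
    (fun σ => (univ.filter fun v => c' (σ v) = c v).card) univ_nonempty
  refine ⟨σ, ?_⟩
  have hsw : ∀ u v, c v ≠ c' (σ v) → c' (σ u) = c v → c u = c v := by
    intro u v hv hu
    by_contra huv
    have h1 := hmax (σ * Equiv.swap u v) (mem_univ _)
    have huv' : u ≠ v := fun h => huv (by rw [h])
    have h2 : (univ.filter fun x => c' (σ x) = c x) ⊂
        (univ.filter fun x => c' ((σ * Equiv.swap u v) x) = c x) := by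
      rw [ssubset_iff_of_subset]
      · refine ⟨v, ?_, ?_⟩
        · rw [mem_filter]
          refine ⟨mem_univ _, ?_⟩
          rw [Equiv.Perm.mul_apply, Equiv.swap_apply_right]
          exact hu
        · simp [Ne.symm hv]
      · intro x hx
        rw [mem_filter] at hx ⊢
        refine ⟨mem_univ _, ?_⟩
        have hxu : x ≠ u := by
          rintro rfl
          exact huv (hx.2.symm.trans hu)
        have hxv : x ≠ v := by
          rintro rfl
          exact hv hx.2.symm
        rw [Equiv.Perm.mul_apply, Equiv.swap_apply_of_ne_of_ne hxu hxv]
        exact hx.2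
    exact absurd (card_lt_card h2) (not_lt.2 h1)
  have hfib : (univ.filter fun v => c' (σ v) ≠ c v).card
      = ∑ i, ((univ.filter fun v => c' (σ v) ≠ c v).filter fun v => c v = i).card :=
    card_eq_sum_card_fiberwise (fun _ _ => by simp)
  rw [hfib]
  push_cast
  refine sum_le_sum fun i _ => ?_
  rcases ((univ.filter fun v => c' (σ v) ≠ c v).filter fun v => c v = i).eq_empty_or_nonempty with h | ⟨v, hv⟩
  · rw [h]; simp
  · simp only [mem_filter, mem_univ, true_and] at hv
    refine le_trans ?_ (le_abs_self _)
    have hcard : (cls c' i).card = ((univ : Finset (Fin n)).filter fun u => c' (σ u) = i).card := by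
      refine (card_bij (fun u _ => σ u) ?_ ?_ ?_).symm
      · intro u hu; rw [mem_cls]; exact (mem_filter.1 hu).2
      · intro u _ v _ h; exact σ.injective h
      · intro w hw
        refine ⟨σ.symm w, ?_, by simp⟩
        rw [mem_cls] at hw
        simp [hw]
    have hadd : ((univ.filter fun v => c' (σ v) ≠ c v).filter fun v => c v = i).card
        + ((univ : Finset (Fin n)).filter fun u => c' (σ u) = i).card ≤ (cls c i).card := by
      rw [← card_union_of_disjoint]
      · refine card_le_card ?_
        intro u hu
        rw [mem_cls]
        rw [mem_union] at hu
        rcases hu with hu | hu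
        · exact (mem_filter.1 hu).2
        · have hu' := (mem_filter.1 hu).2
          rw [← hv.2]
          exact hsw u v (Ne.symm hv.1) (by rw [hu', hv.2])
      · rw [disjoint_left]
        intro u hu hu2
        simp only [mem_filter, mem_univ, true_and] at hu hu2
        exact hu.1 (hu2.trans hu.2.symm)
    rw [hcard, le_sub_iff_add_le]
    exact_mod_cast hadd

open Classical in
lemma symm_count {n : ℕ} (G G' : SimpleGraph (Fin n)) (σ : Equiv.Perm (Fin n)) :
    2 * ((symmDiff G'.edgeSet (Sym2.map σ '' G.edgeSet)).ncard : ℝ)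
      = ∑ z : Fin n × Fin n, |ind G z - ind G' (σ z.1, σ z.2)| := by
  set H : SimpleGraph (Fin n) := symmDiff G' (G.map σ.toEmbedding) with hH
  have h1 : H.edgeSet = symmDiff G'.edgeSet (Sym2.map σ '' G.edgeSet) := by
    rw [hH, symmDiff_def, SimpleGraph.edgeSet_sup, SimpleGraph.edgeSet_sdiff, SimpleGraph.edgeSet_sdiff,
      SimpleGraph.edgeSet_map]
    rfl
  rw [← h1, ← two_edges]
  rw [← Equiv.sum_comp (Equiv.prodCongr σ σ)]
  refine sum_congr rfl fun z _ => ?_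
  have h2 : (G.map σ.toEmbedding).Adj (σ z.1) (σ z.2) ↔ G.Adj z.1 z.2 := by
    have := SimpleGraph.map_adj_apply (G := G) (f := σ.toEmbedding) (a := z.1) (b := z.2)
    simpa using this
  have h3 : H.Adj (σ z.1) (σ z.2) ↔ (G'.Adj (σ z.1) (σ z.2) ∧ ¬ G.Adj z.1 z.2) ∨
      (G.Adj z.1 z.2 ∧ ¬ G'.Adj (σ z.1) (σ z.2)) := by
    rw [hH, symmDiff_def, SimpleGraph.sup_adj, SimpleGraph.sdiff_adj, SimpleGraph.sdiff_adj, h2]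
  unfold ind
  simp only [Equiv.prodCongr_apply, Prod.map]
  by_cases a : G.Adj z.1 z.2 <;> by_cases b : G'.Adj (σ z.1) (σ z.2) <;> simp [h3, a, b]

lemma cnt_fst {n : ℕ} (U : Finset (Fin n)) :
    ∑ z : Fin n × Fin n, (if z.1 ∈ U then (1 : ℝ) else 0) = U.card * n := by
  rw [Fintype.sum_prod_type_right]
  simp [mul_comm]

lemma cnt_snd {n : ℕ} (U : Finset (Fin n)) :
    ∑ z : Fin n × Fin n, (if z.2 ∈ U then (1 : ℝ) else 0) = U.card * n := by
  rw [Fintype.sum_prod_type]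
  simp [mul_comm]

theorem final : ∀ ε : ℝ, 0 < ε → ∃ δ : ℝ, 0 < δ ∧ ∃ N : ℕ, 0 < N ∧
      ∀ n : ℕ, N ≤ n → ∀ G G' : SimpleGraph (Fin n),
        (∀ s : Finset (Fin n),
            (∀ x ∈ s, ∀ y ∈ s, x ≠ y → ¬ G.Adj x y) → (s.card : ℝ) ≤ δ * n) →
        (∃ E₁ E₂ : SimpleGraph (Fin n),
            E₁ ⊔ E₂ = G ∧ E₁ ⊓ E₂ = ⊥ ∧ E₁.CliqueFree 3 ∧ E₂.CliqueFree 6) →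
        (5 / 12 - δ) * n ^ 2 ≤ (G.edgeSet.ncard : ℝ) →
        (∀ s : Finset (Fin n),
            (∀ x ∈ s, ∀ y ∈ s, x ≠ y → ¬ G'.Adj x y) → (s.card : ℝ) ≤ δ * n) →
        (∃ E₁ E₂ : SimpleGraph (Fin n),
            E₁ ⊔ E₂ = G' ∧ E₁ ⊓ E₂ = ⊥ ∧ E₁.CliqueFree 3 ∧ E₂.CliqueFree 6) →
        (5 / 12 - δ) * n ^ 2 ≤ (G'.edgeSet.ncard : ℝ) →
        ∃ σ : Fin n ≃ Fin n,
          ((symmDiff G'.edgeSet (Sym2.map σ '' G.edgeSet)).ncard : ℝ) ≤ ε * n ^ 2 := by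
  classical
  intro ε hε
  set τ := min 1 (ε / 14) with hτ
  have hτ0 : 0 < τ := lt_min one_pos (by positivity)
  have hτ1 : τ ≤ 1 := min_le_left _ _
  have hτ2 : τ ≤ ε / 14 := min_le_right _ _
  obtain ⟨δ₁, hδ₁, N, hN, hmain⟩ := near6 (τ ^ 2 / 2) (by positivity)
  set δ := min δ₁ (τ ^ 2 / 4) with hδ
  have hd1 : δ ≤ δ₁ := min_le_left _ _
  have hd2 : δ ≤ τ ^ 2 / 4 := min_le_right _ _
  refine ⟨δ, lt_min hδ₁ (by positivity), N, hN, ?_⟩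
  intro n hn G G' hi hp he hi' hp' he'
  have hn0 : (0 : ℝ) ≤ n := Nat.cast_nonneg _
  have hn2 : (0 : ℝ) ≤ (n : ℝ) ^ 2 := by positivity
  have hmono : (5 / 12 - δ₁) * (n : ℝ) ^ 2 ≤ (5 / 12 - δ) * (n : ℝ) ^ 2 :=
    mul_le_mul_of_nonneg_right (by linarith) hn2
  obtain ⟨c, hc⟩ := hmain n hn G (fun s hs => (hi s hs).trans (mul_le_mul_of_nonneg_right hd1 hn0)) hp
    (hmono.trans he)
  obtain ⟨c', hc'⟩ := hmain n hn G' (fun s hs => (hi' s hs).trans (mul_le_mul_of_nonneg_right hd1 hn0)) hp'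
    (hmono.trans he')
  have hss : 2 * δ + τ ^ 2 / 2 ≤ τ ^ 2 := by linarith
  obtain ⟨hsz, hmi⟩ := sizes G c δ _ τ hτ0 hss he hc
  obtain ⟨hsz', hmi'⟩ := sizes G' c' δ _ τ hτ0 hss he' hc'
  obtain ⟨σ, hσ⟩ := exists_perm c c'
  refine ⟨σ, ?_⟩
  set U := univ.filter fun v => c' (σ v) ≠ c v with hU
  have hUc : (U.card : ℝ) ≤ 12 * τ * n := by
    refine hσ.trans ?_
    calc _ ≤ ∑ i : Fin 6, 2 * (τ * n) := by
          refine sum_le_sum fun i _ => ?_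
          have h1 := abs_le.1 (hsz i)
          have h2 := abs_le.1 (hsz' i)
          rw [abs_le]
          constructor <;> linarith [h1.1, h1.2, h2.1, h2.2]
      _ = _ := by simp; ring
  have hcnt := symm_count G G' σ
  have hre : ∀ F : Fin n × Fin n → ℝ, ∑ z : Fin n × Fin n, F (σ z.1, σ z.2) = ∑ z, F z := fun F =>
    Equiv.sum_comp (Equiv.prodCongr σ σ) F
  have hpt : ∀ z : Fin n × Fin n, |ind G z - ind G' (σ z.1, σ z.2)| ≤
      (if c z.1 = c z.2 then ind G z else 0) + (if c z.1 = c z.2 then 0 else 1 - ind G z)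
      + ((if c' (σ z.1) = c' (σ z.2) then ind G' (σ z.1, σ z.2) else 0)
      + (if c' (σ z.1) = c' (σ z.2) then 0 else 1 - ind G' (σ z.1, σ z.2)))
      + ((if z.1 ∈ U then 1 else 0) + (if z.2 ∈ U then 1 else 0)) := by
    intro z
    have a0 := ind_nonneg G z
    have a1 := ind_le_one G z
    have b0 := ind_nonneg G' (σ z.1, σ z.2)
    have b1 := ind_le_one G' (σ z.1, σ z.2)
    by_cases h1 : z.1 ∈ U
    · rw [if_pos h1, abs_le]
      constructor <;> split_ifs <;> linarith
    · by_cases h2 : z.2 ∈ U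
      · rw [if_pos h2, abs_le]
        constructor <;> split_ifs <;> linarith
      · rw [if_neg h1, if_neg h2]
        simp only [hU, mem_filter, mem_univ, true_and, not_not] at h1 h2
        rw [h1, h2, abs_le]
        constructor <;> split_ifs <;> linarith
  have hsum := sum_le_sum fun z (_ : z ∈ (univ : Finset (Fin n × Fin n))) => hpt z
  simp only [sum_add_distrib] at hsum
  rw [← hcnt, hre (fun z => if c' z.1 = c' z.2 then ind G' z else 0),
    hre (fun z => if c' z.1 = c' z.2 then 0 else 1 - ind G' z)] at hsum
  have hU1 : ∑ z : Fin n × Fin n, (if z.1 ∈ U then (1 : ℝ) else 0) = U.card * n := by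
    exact cnt_fst U
  have hU2 : ∑ z : Fin n × Fin n, (if z.2 ∈ U then (1 : ℝ) else 0) = U.card * n := by
    exact cnt_snd U
  rw [hU1, hU2] at hsum
  have hUn : (U.card : ℝ) * n ≤ 12 * τ * (n : ℝ) ^ 2 := by nlinarith
  have ht2 : τ ^ 2 ≤ τ := by nlinarith
  have hfin : 2 * τ ^ 2 + 12 * τ ≤ ε := by linarith
  have := mul_le_mul_of_nonneg_right hfin hn2
  have hpos : 0 ≤ τ ^ 2 * (n : ℝ) ^ 2 := by positivity
  linarith

end RT36

end

/-- Weak stability for RT(n,3,6,o(n)): any two near-extremal (K₃,K₆)-free graphs with small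
independence number are within edit distance εn² of each other (up to relabelling). -/
theorem rt_3_6_weak_stability :
    ∀ ε : ℝ, 0 < ε → ∃ δ : ℝ, 0 < δ ∧ ∃ N : ℕ, 0 < N ∧
      ∀ n : ℕ, N ≤ n → ∀ G G' : SimpleGraph (Fin n),
        (∀ s : Finset (Fin n),
            (∀ x ∈ s, ∀ y ∈ s, x ≠ y → ¬ G.Adj x y) → (s.card : ℝ) ≤ δ * n) →
        (∃ E₁ E₂ : SimpleGraph (Fin n),
            E₁ ⊔ E₂ = G ∧ E₁ ⊓ E₂ = ⊥ ∧ E₁.CliqueFree 3 ∧ E₂.CliqueFree 6) →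
        (5 / 12 - δ) * n ^ 2 ≤ (G.edgeSet.ncard : ℝ) →
        (∀ s : Finset (Fin n),
            (∀ x ∈ s, ∀ y ∈ s, x ≠ y → ¬ G'.Adj x y) → (s.card : ℝ) ≤ δ * n) →
        (∃ E₁ E₂ : SimpleGraph (Fin n),
            E₁ ⊔ E₂ = G' ∧ E₁ ⊓ E₂ = ⊥ ∧ E₁.CliqueFree 3 ∧ E₂.CliqueFree 6) →
        (5 / 12 - δ) * n ^ 2 ≤ (G'.edgeSet.ncard : ℝ) →
        ∃ σ : Fin n ≃ Fin n,
          ((symmDiff G'.edgeSet (Sym2.map σ '' G.edgeSet)).ncard : ℝ) ≤ ε * n ^ 2 := by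
  exact RT36.final
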